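/- Let s be a positive integer, k a nonnegative integer, 0 < λ < λ' < 1, δ > δ', and T > 0. Then the embedding F^{k,s(s,λ,λ',δ)}_T ↪ F^{k+1,s(s−1,λ,λ',δ')}_T is compact: every sequence bounded in the norm of F^{k,s(s,λ,λ',δ)}_T has a subsequence converging in the norm of F^{k+1,s(s−1,λ,λ',δ')}_T. -/

import Mathlib

open scoped BigOperators ENNReal Classical
open Filter MeasureTheory

noncomputable section

namespace NSdeRham

/-- Euclidean space `ℝⁿ`. -/
abbrev Spc (n : ℕ) := EuclideanSpace ℝ (Fin n)

variable {n : ℕ}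

/-- The weight `w(x) = √(1+|x|²)`. -/
def wt (x : Spc n) : ℝ := Real.sqrt (1 + ‖x‖ ^ 2)

/-- `w(x,y) = max (w x) (w y)`. -/
def wt2 (x y : Spc n) : ℝ := max (wt x) (wt y)

/-- Partial derivative in the `i`-th coordinate direction. -/
def pd (i : Fin n) (f : Spc n → ℝ) (x : Spc n) : ℝ :=
  fderiv ℝ f x (EuclideanSpace.single i 1)

/-- The Laplace operator `Δ = ∑ ∂²/∂xᵢ²`. -/
def lap (f : Spc n → ℝ) (x : Spc n) : ℝ := ∑ i : Fin n, pd i (pd i f) x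

section enorms

variable {F : Type*} [NormedAddCommGroup F]

/-- Weighted sup-"norm" `sup_x w(x)^δ ‖g x‖` (with values in `ℝ≥0∞`). -/
def eWSup (δ : ℝ) (g : Spc n → F) : ℝ≥0∞ :=
  ⨆ x : Spc n, ENNReal.ofReal (wt x ^ δ * ‖g x‖)

/-- Weighted Hölder seminorm `⟨g⟩_{λ,δ}`. -/
def eWHold (lam δ : ℝ) (g : Spc n → F) : ℝ≥0∞ :=
  ⨆ (x : Spc n) (y : Spc n) (_ : x ≠ y ∧ ‖x - y‖ ≤ ‖x‖ / 2),
    ENNReal.ofReal (wt2 x y ^ (δ + lam) * ‖g x - g y‖ / ‖x - y‖ ^ lam)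

/-- The ordinary Hölder norm on the (closed) unit ball around the origin. -/
def eOHold (lam : ℝ) (g : Spc n → F) : ℝ≥0∞ :=
  (⨆ (x : Spc n) (_ : ‖x‖ ≤ 1), ENNReal.ofReal ‖g x‖) +
    ⨆ (x : Spc n) (y : Spc n) (_ : ‖x‖ ≤ 1 ∧ ‖y‖ ≤ 1 ∧ x ≠ y),
      ENNReal.ofReal (‖g x - g y‖ / ‖x - y‖ ^ lam)

/-- The norm of `C^{0,λ,δ}`; for `λ = 0` this is just the weighted sup-norm. -/
def eHol0 (lam δ : ℝ) (g : Spc n → F) : ℝ≥0∞ :=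
  if lam = 0 then eWSup δ g else eOHold lam g + eWSup δ g + eWHold lam δ g

/-- The norm of the base anisotropic space `C^{𝐬(0,λ,δ)}_T`. -/
def eAniso0 (T lam δ : ℝ) (v : ℝ → Spc n → F) : ℝ≥0∞ :=
  (⨆ t : Set.Icc (0 : ℝ) T, eHol0 lam δ (v t)) +
    if lam = 0 then 0 else
      ⨆ (t₁ : Set.Icc (0 : ℝ) T) (t₂ : Set.Icc (0 : ℝ) T) (_ : (t₁ : ℝ) ≠ (t₂ : ℝ))
        (x : Spc n),
        ENNReal.ofReal (wt x ^ δ * ‖v t₁ x - v t₂ x‖ / |(t₁ : ℝ) - (t₂ : ℝ)| ^ (lam / 2))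

end enorms

/-- The norm of the static weighted Hölder space `C^{s,λ,δ}`. -/
def eHolS (s : ℕ) (lam δ : ℝ) (g : Spc n → ℝ) : ℝ≥0∞ :=
  ∑ m ∈ Finset.range (s + 1), eHol0 lam (δ + m) (iteratedFDeriv ℝ m g)

/-- Membership in the static weighted Hölder space `C^{s,λ,δ}`. -/
def HolSMem (s : ℕ) (lam δ : ℝ) (g : Spc n → ℝ) : Prop :=
  ContDiff ℝ s g ∧ eHolS s lam δ g ≠ ⊤

/-- Time derivative of order `j` (within `[0,T]`). -/
def tDeriv (T : ℝ) (j : ℕ) (u : ℝ → Spc n → ℝ) (t : ℝ) (x : Spc n) : ℝ :=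
  iteratedDerivWithin j (fun τ => u τ x) (Set.Icc 0 T) t

/-- Mixed derivative `∂_x^m ∂_t^j`. -/
def mixDeriv (T : ℝ) (m j : ℕ) (u : ℝ → Spc n → ℝ) (t : ℝ) :
    Spc n → ContinuousMultilinearMap ℝ (fun _ : Fin m => Spc n) ℝ :=
  iteratedFDeriv ℝ m (fun x => tDeriv T j u t x)

/-- The norm of the anisotropic weighted parabolic Hölder space `C^{k,𝐬(s,λ,δ)}_T`. -/
def eAnisoKS (T : ℝ) (k s : ℕ) (lam δ : ℝ) (u : ℝ → Spc n → ℝ) : ℝ≥0∞ :=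
  ∑ b ∈ Finset.range (k + 1), ∑ m ∈ Finset.range (2 * s + 1), ∑ j ∈ Finset.range (s + 1),
    if m + 2 * j ≤ 2 * s then eAniso0 T lam (δ + b + m) (mixDeriv T (b + m) j u) else 0

/-- Regularity required of members of `C^{k,𝐬(s,λ,δ)}_T`. -/
def AnisoReg (T : ℝ) (k s : ℕ) (u : ℝ → Spc n → ℝ) : Prop :=
  (∀ x : Spc n, ContDiffOn ℝ s (fun t => u t x) (Set.Icc 0 T)) ∧
  (∀ j : ℕ, j ≤ s → ∀ t ∈ Set.Icc (0 : ℝ) T,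
    ContDiff ℝ (2 * (s - j) + k) (fun x => tDeriv T j u t x)) ∧
  (∀ j m : ℕ, j ≤ s → m + 2 * j ≤ 2 * s + k →
    Continuous fun p : Set.Icc (0 : ℝ) T × Spc n => mixDeriv T m j u p.1 p.2)

/-- Membership in `C^{k,𝐬(s,λ,δ)}_T`. -/
def AnisoMem (T : ℝ) (k s : ℕ) (lam δ : ℝ) (u : ℝ → Spc n → ℝ) : Prop :=
  AnisoReg T k s u ∧ eAnisoKS T k s lam δ u ≠ ⊤

/-- The norm of `𝓕^{k,𝐬(s,λ,λ',δ)}_T = C^{k+1,𝐬(s,λ,δ)}_T ∩ C^{k,𝐬(s,λ',δ)}_T`. -/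
def eFn (T : ℝ) (k s : ℕ) (lam lam' δ : ℝ) (u : ℝ → Spc n → ℝ) : ℝ≥0∞ :=
  eAnisoKS T (k + 1) s lam δ u + eAnisoKS T k s lam' δ u

/-- Membership in `𝓕^{k,𝐬(s,λ,λ',δ)}_T`. -/
def FMem (T : ℝ) (k s : ℕ) (lam lam' δ : ℝ) (u : ℝ → Spc n → ℝ) : Prop :=
  AnisoReg T (k + 1) s u ∧ eFn T k s lam lam' δ u ≠ ⊤

/-- Index set of a basis of `Λ^q`. -/
abbrev Idx (n q : ℕ) := {I : Finset (Fin n) // I.card = q}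

/-- Static differential `q`-forms: coefficient functions. -/
abbrev FormS (n q : ℕ) := Idx n q → Spc n → ℝ

/-- Time-dependent differential `q`-forms. -/
abbrev FormT (n q : ℕ) := Idx n q → ℝ → Spc n → ℝ

/-- Fibre of the bundle `Λ^q`. -/
abbrev Fib (n q : ℕ) := Idx n q → ℝ

/-- The exterior derivative `d_q` on static `q`-forms. -/
def dS {q : ℕ} (u : FormS n q) : FormS n (q + 1) := fun J x =>
  ∑ i : Fin n,
    if h : i ∈ J.1 then
      (-1 : ℝ) ^ (J.1.filter fun j => j < i).card *
        pd i (u ⟨J.1.erase i, by simp [Finset.card_erase_of_mem h, J.2]⟩) x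
    else 0

/-- The exterior derivative `d_{q-1}` mapping `(q-1)`-forms to `q`-forms. -/
def dLowS {q : ℕ} (p : FormS n (q - 1)) : FormS n q := fun J x =>
  ∑ i : Fin n,
    if h : i ∈ J.1 ∧ (J.1.erase i).card = q - 1 then
      (-1 : ℝ) ^ (J.1.filter fun j => j < i).card * pd i (p ⟨J.1.erase i, h.2⟩) x
    else 0

/-- The formal adjoint `d_{q-1}^*` mapping `q`-forms to `(q-1)`-forms. -/
def coDS {q : ℕ} (u : FormS n q) : FormS n (q - 1) := fun K x =>
  -∑ i : Fin n,
    if h : i ∉ K.1 ∧ (insert i K.1).card = q then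
      (-1 : ℝ) ^ (K.1.filter fun j => j < i).card * pd i (u ⟨insert i K.1, h.2⟩) x
    else 0

/-- `d_q` on time-dependent forms. -/
def dT {q : ℕ} (u : FormT n q) : FormT n (q + 1) := fun J t => dS (fun I => u I t) J

/-- `d_{q-1}` on time-dependent forms. -/
def dLowT {q : ℕ} (p : FormT n (q - 1)) : FormT n q := fun J t => dLowS (fun I => p I t) J

/-- `d_{q-1}^*` on time-dependent forms. -/
def coDT {q : ℕ} (u : FormT n q) : FormT n (q - 1) := fun K t => coDS (fun I => u I t) K

/-- Norm of `C^{k,𝐬(s,λ,δ)}_{T,Λ^q}`. -/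
def eAnisoKSF {q : ℕ} (T : ℝ) (k s : ℕ) (lam δ : ℝ) (u : FormT n q) : ℝ≥0∞ :=
  ∑ I : Idx n q, eAnisoKS T k s lam δ (u I)

/-- Membership in `C^{k,𝐬(s,λ,δ)}_{T,Λ^q}`. -/
def CMemF {q : ℕ} (T : ℝ) (k s : ℕ) (lam δ : ℝ) (u : FormT n q) : Prop :=
  (∀ I, AnisoReg T k s (u I)) ∧ eAnisoKSF T k s lam δ u ≠ ⊤

/-- Graph norm of `C^{k,𝐬(s,λ,δ)}_{T,Λ^q,𝒟_{d⊕d*}}`. -/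
def eCD {q : ℕ} (T : ℝ) (k s : ℕ) (lam δ : ℝ) (u : FormT n q) : ℝ≥0∞ :=
  eAnisoKSF T k s lam δ u + eAnisoKSF T k s lam (δ + 1) (dT u) +
    eAnisoKSF T k s lam (δ + 1) (coDT u)

/-- Membership in `C^{k,𝐬(s,λ,δ)}_{T,Λ^q,𝒟_{d⊕d*}}`. -/
def CMemD {q : ℕ} (T : ℝ) (k s : ℕ) (lam δ : ℝ) (u : FormT n q) : Prop :=
  CMemF T k s lam δ u ∧ CMemF T k s lam (δ + 1) (dT u) ∧ CMemF T k s lam (δ + 1) (coDT u)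

/-- Norm of `𝓕^{k,𝐬(s,λ,λ',δ)}_{T,Λ^q}`. -/
def eFF {q : ℕ} (T : ℝ) (k s : ℕ) (lam lam' δ : ℝ) (u : FormT n q) : ℝ≥0∞ :=
  ∑ I : Idx n q, eFn T k s lam lam' δ (u I)

/-- Membership in `𝓕^{k,𝐬(s,λ,λ',δ)}_{T,Λ^q}`. -/
def FMemF {q : ℕ} (T : ℝ) (k s : ℕ) (lam lam' δ : ℝ) (u : FormT n q) : Prop :=
  (∀ I, AnisoReg T (k + 1) s (u I)) ∧ eFF T k s lam lam' δ u ≠ ⊤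

/-- Graph norm of `𝓕^{k,𝐬(s,λ,λ',δ)}_{T,Λ^q,𝒟_{d⊕d*}}`. -/
def eFD {q : ℕ} (T : ℝ) (k s : ℕ) (lam lam' δ : ℝ) (u : FormT n q) : ℝ≥0∞ :=
  eFF T k s lam lam' δ u + eFF T k s lam lam' (δ + 1) (dT u) +
    eFF T k s lam lam' (δ + 1) (coDT u)

/-- Membership in `𝓕^{k,𝐬(s,λ,λ',δ)}_{T,Λ^q,𝒟_{d⊕d*}}`. -/
def FMemD {q : ℕ} (T : ℝ) (k s : ℕ) (lam lam' δ : ℝ) (u : FormT n q) : Prop :=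
  FMemF T k s lam lam' δ u ∧ FMemF T k s lam lam' (δ + 1) (dT u) ∧
    FMemF T k s lam lam' (δ + 1) (coDT u)

/-- Norm of the static space `C^{s,λ,δ}_{Λ^q}`. -/
def eHolSF {q : ℕ} (s : ℕ) (lam δ : ℝ) (g : FormS n q) : ℝ≥0∞ :=
  ∑ I : Idx n q, eHolS s lam δ (g I)

/-- Membership in the static space `C^{s,λ,δ}_{Λ^q}`. -/
def HolMemF {q : ℕ} (s : ℕ) (lam δ : ℝ) (g : FormS n q) : Prop :=
  (∀ I, ContDiff ℝ s (g I)) ∧ eHolSF s lam δ g ≠ ⊤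

/-- Equality of time-dependent forms on `ℝⁿ × [0,T]`. -/
def EqOnT {q : ℕ} (T : ℝ) (u v : FormT n q) : Prop :=
  ∀ I, ∀ t ∈ Set.Icc (0 : ℝ) T, ∀ x, u I t x = v I t x

/-- The form `u` is co-closed (`d^* u = 0`) on `ℝⁿ × [0,T]`. -/
def CoClosed {q : ℕ} (T : ℝ) (u : FormT n q) : Prop :=
  ∀ K, ∀ t ∈ Set.Icc (0 : ℝ) T, ∀ x, coDT u K t x = 0

/-- Type of the bilinear zero order operator `M₁^{(q)}`. -/
abbrev M1Type (n q : ℕ) := (Fib n (q + 1) × Fib n (q - 1)) →ₗ[ℝ] Fib n q →ₗ[ℝ] Fib n q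

/-- Type of the bilinear zero order operator `M₂^{(q)}`. -/
abbrev M2Type (n q : ℕ) := Fib n q →ₗ[ℝ] Fib n q →ₗ[ℝ] Fib n (q - 1)

/-- Value of a time-dependent form at a point, as an element of the fibre. -/
def fib {q : ℕ} (u : FormT n q) (t : ℝ) (x : Spc n) : Fib n q := fun I => u I t x

/-- Value of `(d_q ⊕ d_{q-1}^*) u` at a point. -/
def ddFib {q : ℕ} (u : FormT n q) (t : ℝ) (x : Spc n) : Fib n (q + 1) × Fib n (q - 1) :=
  (fun J => dT u J t x, fun K => coDT u K t x)

/-- The operator `W_q u = M₁((d⊕d^*)u, w) + M₁((d⊕d^*)w, u)`. -/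
def Wop {q : ℕ} (M₁ : M1Type n q) (w u : FormT n q) : FormT n q := fun I t x =>
  M₁ (ddFib u t x) (fib w t x) I + M₁ (ddFib w t x) (fib u t x) I

/-- The symmetric bilinearization `B_q(w,u)` of the nonlinearity. -/
def Bop {q : ℕ} (M₁ : M1Type n q) (M₂ : M2Type n q) (w u : FormT n q) : FormT n q :=
  fun I t x =>
    Wop M₁ w u I t x +
      dLowT (fun K t' x' =>
        M₂ (fib u t' x') (fib w t' x') K + M₂ (fib w t' x') (fib u t' x') K) I t x

/-- The nonlinearity `𝒩_q u = M₁((d⊕d^*)u, u) + d_{q-1} M₂(u,u)`. -/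
def Nop {q : ℕ} (M₁ : M1Type n q) (M₂ : M2Type n q) (u : FormT n q) : FormT n q :=
  fun I t x =>
    M₁ (ddFib u t x) (fib u t x) I +
      dLowT (fun K t' x' => M₂ (fib u t' x') (fib u t' x') K) I t x

/-- Fundamental solution of the heat operator `∂_t - μΔ`. -/
def heatKer (μ : ℝ) (x : Spc n) (t : ℝ) : ℝ :=
  if 0 < t then (4 * Real.pi * μ * t) ^ (-(n : ℝ) / 2) * Real.exp (-‖x‖ ^ 2 / (4 * μ * t))
  else 0

/-- Volume heat potential `Ψ_μ`. -/
def volPot (μ : ℝ) (f : ℝ → Spc n → ℝ) (t : ℝ) (x : Spc n) : ℝ :=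
  ∫ τ in Set.Ioc (0 : ℝ) t, ∫ y : Spc n, heatKer μ (x - y) (t - τ) * f τ y

/-- Poisson heat potential `Ψ_{μ,0}`. -/
def poisPot (μ : ℝ) (g : Spc n → ℝ) (t : ℝ) (x : Spc n) : ℝ :=
  ∫ y : Spc n, heatKer μ (x - y) t * g y

/-- Volume heat potential acting coefficient-wise on forms. -/
def volPotF {q : ℕ} (μ : ℝ) (f : FormT n q) : FormT n q := fun I => volPot μ (f I)

/-- Poisson heat potential acting coefficient-wise on forms. -/
def poisPotF {q : ℕ} (μ : ℝ) (g : FormS n q) : FormT n q := fun I => poisPot μ (g I)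

/-- Area of the unit sphere in `ℝⁿ`. -/
def sphArea (n : ℕ) : ℝ := 2 * Real.pi ^ ((n : ℝ) / 2) / Real.Gamma ((n : ℝ) / 2)

/-- Standard fundamental solution of the Laplace operator in `ℝⁿ`. -/
def lapKer (n : ℕ) (x : Spc n) : ℝ :=
  if n = 2 then (1 / Real.pi) * Real.log ‖x‖
  else ‖x‖ ^ (2 - (n : ℝ)) / (sphArea n * (2 - (n : ℝ)))

/-- Newtonian potential. -/
def newtPot (f : Spc n → ℝ) (x : Spc n) : ℝ := ∫ y : Spc n, lapKer n (x - y) * f y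

/-- The integral operator `Φ_q` mapping `(q+1)`-forms to `q`-forms;
concretely `Φ_q f = -d^* (e * f)`. -/
def PhiOp {q : ℕ} (f : FormT n (q + 1)) : FormT n q := fun K t x =>
  -coDS (n := n) (q := q + 1) (fun J y => newtPot (fun z => f J t z) y) K x

/-- Squared `L²` norm of a form at time `t`. -/
def l2Sq {q : ℕ} (u : FormT n q) (t : ℝ) : ℝ :=
  ∑ I : Idx n q, ∫ x : Spc n, (u I t x) ^ 2

/-- Squared `L²` norm of the spatial gradient of a form at time `t`. -/
def gradSq {q : ℕ} (u : FormT n q) (t : ℝ) : ℝ :=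
  ∑ I : Idx n q, ∑ i : Fin n, ∫ x : Spc n, (pd i (fun y => u I t y) x) ^ 2

/-- The norm of `C^{0,𝐬(0,0,δ)}_{T,Λ^q}` (weighted sup-norm). -/
def eSupT {q : ℕ} (T δ : ℝ) (u : FormT n q) : ℝ≥0∞ :=
  ∑ I : Idx n q,
    ⨆ (t : Set.Icc (0 : ℝ) T) (x : Spc n), ENNReal.ofReal (wt x ^ δ * |u I t x|)

/-- The norm `‖∇u‖_{C^{0,𝐬(0,0,δ)}_{T}}` of the spatial gradient. -/
def eSupGradT {q : ℕ} (T δ : ℝ) (u : FormT n q) : ℝ≥0∞ :=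
  ∑ I : Idx n q, ∑ i : Fin n,
    ⨆ (t : Set.Icc (0 : ℝ) T) (x : Spc n),
      ENNReal.ofReal (wt x ^ δ * |pd i (fun y => u I t y) x|)

/-- `q`-form with coefficients harmonic polynomials of degree at most `m`. -/
def HarmPolyForm {q : ℕ} (m : ℕ) (h : FormS n q) : Prop :=
  ∀ I, (∃ P : MvPolynomial (Fin n) ℝ, P.totalDegree ≤ m ∧
      ∀ x : Spc n, h I x = MvPolynomial.eval (fun i => x i) P) ∧
    ∀ x : Spc n, lap (h I) x = 0

/-- Classical solution of the Cauchy problem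
`∂_t u - μ Δ u + extra = f` on `ℝⁿ × (0,T)`, `u(·,0) = u₀`. -/
def CauchySol {q : ℕ} (T μ : ℝ) (u extra f : FormT n q) (u₀ : FormS n q) : Prop :=
  (∀ I, ∀ t ∈ Set.Ioo (0 : ℝ) T, ∀ x,
    deriv (fun τ => u I τ x) t - μ * lap (fun y => u I t y) x + extra I t x = f I t x) ∧
  ∀ I x, u I 0 x = u₀ I x

/-- `Ψ_{μ,q} 𝒩_q u`. -/
def NopPot {q : ℕ} (μ : ℝ) (M₁ : M1Type n q) (M₂ : M2Type n q) (u : FormT n q) : FormT n q :=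
  volPotF μ (Nop M₁ M₂ u)

/-- `u + Ψ_{μ,q} 𝒩_q u`. -/
def TmapN {q : ℕ} (μ : ℝ) (M₁ : M1Type n q) (M₂ : M2Type n q) (u : FormT n q) : FormT n q :=
  u + NopPot μ M₁ M₂ u

/-- The linearization `u + Ψ_{μ,q} B_q(v,u)`. -/
def LmapB {q : ℕ} (μ : ℝ) (M₁ : M1Type n q) (M₂ : M2Type n q) (v u : FormT n q) :
    FormT n q :=
  u + volPotF μ (Bop M₁ M₂ v u)

/-- `Φ_q d_q Ψ_{μ,q} 𝒩_q u`. -/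
def PhiNpot {q : ℕ} (μ : ℝ) (M₁ : M1Type n q) (M₂ : M2Type n q) (u : FormT n q) :
    FormT n q :=
  PhiOp (dT (volPotF μ (Nop M₁ M₂ u)))

/-- `u + Φ_q d_q Ψ_{μ,q} 𝒩_q u`. -/
def PhiNmap {q : ℕ} (μ : ℝ) (M₁ : M1Type n q) (M₂ : M2Type n q) (u : FormT n q) :
    FormT n q :=
  u + PhiNpot μ M₁ M₂ u

/-- The linearization `u + Φ_q d_q Ψ_{μ,q} B_q(v,u)`. -/
def PhiLmap {q : ℕ} (μ : ℝ) (M₁ : M1Type n q) (M₂ : M2Type n q) (v u : FormT n q) :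
    FormT n q :=
  u + PhiOp (dT (volPotF μ (Bop M₁ M₂ v u)))

section weights

theorem one_le_wt (x : Spc n) : 1 ≤ wt x :=
  Real.one_le_sqrt.2 (le_add_of_nonneg_right (sq_nonneg _))

theorem wt_pos (x : Spc n) : 0 < wt x := zero_lt_one.trans_le (one_le_wt x)

theorem norm_le_wt (x : Spc n) : ‖x‖ ≤ wt x :=
  Real.le_sqrt_of_sq_le (le_add_of_nonneg_left zero_le_one)

theorem wt_le_of_norm_le {x y : Spc n} (h : ‖x‖ ≤ ‖y‖) : wt x ≤ wt y :=
  Real.sqrt_le_sqrt (by gcongr)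

theorem wt_le_three_mul {x z : Spc n} (h : ‖x‖ ≤ 3 * ‖z‖) : wt x ≤ 3 * wt z := by
  unfold wt
  rw [Real.sqrt_le_iff]
  refine ⟨by positivity, ?_⟩
  rw [mul_pow, Real.sq_sqrt (by positivity)]
  nlinarith [norm_nonneg x]

theorem wt_le_three {x : Spc n} (h : ‖x‖ ≤ 1) : wt x ≤ 3 := by
  unfold wt
  rw [Real.sqrt_le_iff]
  exact ⟨by positivity, by nlinarith [norm_nonneg x]⟩

theorem continuous_wt : Continuous (wt : Spc n → ℝ) := by
  unfold wt; fun_prop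

theorem continuous_wt_rpow (r : ℝ) : Continuous fun x : Spc n => wt x ^ r :=
  continuous_wt.rpow_const fun x => Or.inl (wt_pos x).ne'

theorem one_le_wt2 (x y : Spc n) : 1 ≤ wt2 x y := (one_le_wt x).trans (le_max_left _ _)

theorem wt2_pos (x y : Spc n) : 0 < wt2 x y := zero_lt_one.trans_le (one_le_wt2 x y)

/-- The pairs of points entering the weighted and the ordinary Hölder seminorms. -/
def Near (x y : Spc n) : Prop := ‖x - y‖ ≤ ‖x‖ / 2 ∨ ‖x‖ ≤ 1 ∧ ‖y‖ ≤ 1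

theorem Near.wt2_le {x y z : Spc n} (h : Near x y) (hz : z ∈ segment ℝ x y) :
    wt2 x y ≤ 3 * wt z := by
  rcases h with h | ⟨hx, hy⟩
  · have h1 : ‖z - x‖ ≤ ‖x‖ / 2 := by
      have : z ∈ Metric.closedBall x (‖x‖ / 2) :=
        (convex_closedBall x _).segment_subset (Metric.mem_closedBall_self (by positivity))
          (by simpa [dist_eq_norm, norm_sub_rev] using h) hz
      simpa [dist_eq_norm] using this
    have h2 : ‖x‖ ≤ ‖z‖ + ‖z - x‖ := by
      simpa using norm_sub_le z (z - x)
    have h3 : ‖y‖ ≤ ‖x‖ + ‖x - y‖ := by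
      simpa using norm_sub_le x (x - y)
    exact max_le (wt_le_three_mul (by linarith [norm_nonneg z]))
      (wt_le_three_mul (by linarith))
  · have := one_le_wt z
    exact max_le ((wt_le_three hx).trans (by linarith)) ((wt_le_three hy).trans (by linarith))

theorem wt_le_wt2 {x y z : Spc n} (hz : z ∈ segment ℝ x y) : wt z ≤ wt2 x y := by
  have : z ∈ Metric.closedBall (0 : Spc n) (max ‖x‖ ‖y‖) :=
    (convex_closedBall 0 _).segment_subset (by simp) (by simp) hz
  rw [mem_closedBall_zero_iff] at this
  rcases le_max_iff.1 this with h | h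
  · exact (wt_le_of_norm_le h).trans (le_max_left _ _)
  · exact (wt_le_of_norm_le h).trans (le_max_right _ _)

theorem rpow_le_three_rpow_mul {a b : ℝ} (ha : 0 < a) (hb : 0 < b) (hab : a ≤ 3 * b)
    (hba : b ≤ 3 * a) (r : ℝ) : a ^ r ≤ 3 ^ |r| * b ^ r := by
  rw [← div_le_iff₀ (by positivity), ← Real.div_rpow ha.le hb.le]
  rcases le_total 0 r with hr | hr
  · rw [abs_of_nonneg hr]
    exact Real.rpow_le_rpow (by positivity) ((div_le_iff₀ hb).2 hab) hr
  · rw [abs_of_nonpos hr, ← inv_div, Real.inv_rpow (by positivity), ← Real.rpow_neg (by positivity)]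
    exact Real.rpow_le_rpow (by positivity) ((div_le_iff₀ ha).2 hba) (by linarith)

theorem Near.wt2_rpow_le {x y z : Spc n} (h : Near x y) (hz : z ∈ segment ℝ x y) (r : ℝ) :
    wt2 x y ^ r ≤ 3 ^ |r| * wt z ^ r :=
  rpow_le_three_rpow_mul (wt2_pos x y) (wt_pos z) (h.wt2_le hz)
    ((wt_le_wt2 hz).trans (by linarith [wt2_pos x y])) r

theorem one_le_three_rpow_mul {a : ℝ} (h1 : 1 ≤ a) (h3 : a ≤ 3) (r : ℝ) :
    1 ≤ 3 ^ |r| * a ^ r := by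
  simpa using rpow_le_three_rpow_mul one_pos (one_pos.trans_le h1) (by linarith) (by linarith) r

end weights

section interpolation

variable {F : Type*} [NormedAddCommGroup F]

/-- Interpolation between a Hölder bound and a sup bound. -/
theorem div_rpow_le_interpolation {D A B d θ μ : ℝ} (hD : 0 ≤ D) (hA : 0 ≤ A)
    (hd : 0 < d) (hμ : 0 < μ) (hθ : μ < θ) (h1 : D ≤ A * d ^ θ) (h2 : D ≤ B) :
    D / d ^ μ ≤ A ^ (μ / θ) * B ^ (1 - μ / θ) := by
  have hθ0 : 0 < θ := hμ.trans hθ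
  have hq : μ / θ < 1 := (div_lt_one hθ0).2 hθ
  rw [div_le_iff₀ (by positivity)]
  calc D = D ^ (μ / θ) * D ^ (1 - μ / θ) := by
        rw [← Real.rpow_add_of_nonneg hD (by positivity) (by linarith)]; simp
    _ ≤ (A * d ^ θ) ^ (μ / θ) * B ^ (1 - μ / θ) := by
        have : 0 ≤ 1 - μ / θ := by linarith
        gcongr
    _ = A ^ (μ / θ) * B ^ (1 - μ / θ) * d ^ μ := by
        rw [Real.mul_rpow hA (by positivity), ← Real.rpow_mul hd.le, mul_div_cancel₀ _ hθ0.ne']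
        ring

/-- Weighted sup bound, weighted Lipschitz bound in space, and weighted Hölder bound of exponent
`θ` in time, all with constant `C`. -/
def HB (T C σ θ : ℝ) (f : Set.Icc (0 : ℝ) T × Spc n → F) : Prop :=
  (∀ t x, wt x ^ σ * ‖f (t, x)‖ ≤ C) ∧
  (∀ t x y, Near x y → wt2 x y ^ (σ + 1) * ‖f (t, x) - f (t, y)‖ ≤ C * ‖x - y‖) ∧
  ∀ (t₁ t₂ : Set.Icc (0 : ℝ) T) (x), wt x ^ σ * ‖f (t₁, x) - f (t₂, x)‖ ≤
    C * |(t₁ : ℝ) - t₂| ^ θ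

theorem HB.sub {T C C' σ θ : ℝ} {f g : Set.Icc (0 : ℝ) T × Spc n → F} (hf : HB T C σ θ f)
    (hg : HB T C' σ θ g) : HB T (C + C') σ θ (f - g) := by
  have key : ∀ {w : ℝ} {a b : F}, 0 ≤ w → w * ‖a - b‖ ≤ w * ‖a‖ + w * ‖b‖ := fun {w a b} hw => by
    rw [← mul_add]; exact mul_le_mul_of_nonneg_left (norm_sub_le a b) hw
  refine ⟨fun t x => ?_, fun t x y h => ?_, fun t₁ t₂ x => ?_⟩
  · exact (key (Real.rpow_nonneg (wt_pos x).le _)).trans (add_le_add (hf.1 t x) (hg.1 t x))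
  · rw [Pi.sub_apply, Pi.sub_apply, sub_sub_sub_comm, add_mul]
    exact (key (Real.rpow_nonneg (wt2_pos x y).le _)).trans
      (add_le_add (hf.2.1 t x y h) (hg.2.1 t x y h))
  · rw [Pi.sub_apply, Pi.sub_apply, sub_sub_sub_comm, add_mul]
    exact (key (Real.rpow_nonneg (wt_pos x).le _)).trans
      (add_le_add (hf.2.2 t₁ t₂ x) (hg.2.2 t₁ t₂ x))

theorem HB.nonneg {T C σ θ : ℝ} {f : Set.Icc (0 : ℝ) T × Spc n → F} (hT : 0 ≤ T)
    (hf : HB T C σ θ f) : 0 ≤ C :=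
  (mul_nonneg (Real.rpow_nonneg (wt_pos (0 : Spc n)).le _) (norm_nonneg _)).trans
    (hf.1 ⟨0, le_rfl, hT⟩ 0)

/-- The bound for `eAniso0` obtained by interpolation. -/
def interpBound (C σ σ' θ μ ε : ℝ) : ℝ :=
  (2 * 3 ^ |σ'| * ε + (3 ^ |σ + 1| * C) ^ μ * (2 * 3 ^ |σ'| * ε) ^ (1 - μ) +
    2 * 3 ^ |σ'| * ε + (3 ^ |σ + 1| * C) ^ μ * (2 * 3 ^ |σ'| * ε) ^ (1 - μ)) +
    (3 ^ |σ + 1| * C) ^ (μ / 2 / θ) * (2 * 3 ^ |σ'| * ε) ^ (1 - μ / 2 / θ)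

theorem tendsto_interpBound (C σ σ' : ℝ) {θ μ : ℝ} (hμ : 0 < μ) (hμ1 : μ < 1)
    (hθ : μ / 2 < θ) : Tendsto (interpBound C σ σ' θ μ) (nhds 0) (nhds 0) := by
  have hθ0 : 0 < θ := (half_pos hμ).trans hθ
  have hq : μ / 2 / θ < 1 := (div_lt_one hθ0).2 hθ
  have hc : Continuous (interpBound C σ σ' θ μ) := by
    unfold interpBound
    have h1 : Continuous fun ε : ℝ => (2 * 3 ^ |σ'| * ε) ^ (1 - μ) :=
      Continuous.rpow_const (by fun_prop) fun _ => Or.inr (by linarith)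
    have h2 : Continuous fun ε : ℝ => (2 * 3 ^ |σ'| * ε) ^ (1 - μ / 2 / θ) :=
      Continuous.rpow_const (by fun_prop) fun _ => Or.inr (by linarith)
    fun_prop
  have h0 : interpBound C σ σ' θ μ 0 = 0 := by
    simp [interpBound, Real.zero_rpow (sub_pos.2 hμ1).ne', Real.zero_rpow (sub_pos.2 hq).ne']
  simpa [h0] using hc.tendsto 0

theorem HB.eAniso0_le {T C σ σ' θ μ ε : ℝ} {f : Set.Icc (0 : ℝ) T × Spc n → F}
    (hf : HB T C σ θ f) (hT : 0 ≤ T) (hσ : σ' ≤ σ) (hμ : 0 < μ) (hμ1 : μ < 1) (hθ : μ / 2 < θ)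
    (hε : ∀ t x, wt x ^ σ' * ‖f (t, x)‖ ≤ ε) {v : ℝ → Spc n → F}
    (hv : ∀ (t : Set.Icc (0 : ℝ) T) x, v t x = f (t, x)) :
    eAniso0 T μ σ' v ≤ ENNReal.ofReal (interpBound C σ σ' θ μ ε) := by
  have hC := hf.nonneg hT
  have hε0 : 0 ≤ ε := (mul_nonneg (Real.rpow_nonneg (wt_pos (0 : Spc n)).le _) (norm_nonneg _)).trans
    (hε ⟨0, le_rfl, hT⟩ 0)
  have h31 : ∀ r : ℝ, (1 : ℝ) ≤ 3 ^ |r| := fun r => Real.one_le_rpow (by norm_num) (abs_nonneg r)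
  have hθ0 : 0 < θ := (half_pos hμ).trans hθ
  set B : ℝ := 2 * 3 ^ |σ'| * ε with hB
  set A : ℝ := 3 ^ |σ + 1| * C with hA
  have hA0 : 0 ≤ A := by positivity
  have hB0 : 0 ≤ B := by positivity
  have hCA : C ≤ A := le_mul_of_one_le_left hC (h31 _)
  have hεB : 2 * ε ≤ B := by
    rw [hB]; nlinarith [h31 σ', mul_le_mul_of_nonneg_right (h31 σ') hε0]
  have hsup : ∀ (t : Set.Icc (0 : ℝ) T) (x : Spc n), ‖x‖ ≤ 1 → ‖f (t, x)‖ ≤ 3 ^ |σ'| * ε :=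
    fun t x hx => by
      have h1 := one_le_three_rpow_mul (one_le_wt x) (wt_le_three hx) σ'
      calc ‖f (t, x)‖ ≤ (3 ^ |σ'| * wt x ^ σ') * ‖f (t, x)‖ :=
            le_mul_of_one_le_left (norm_nonneg _) h1
        _ = 3 ^ |σ'| * (wt x ^ σ' * ‖f (t, x)‖) := by ring
        _ ≤ 3 ^ |σ'| * ε := by gcongr; exact hε t x
  have hspace : ∀ t : Set.Icc (0 : ℝ) T, eHol0 μ σ' (v t) ≤
      ENNReal.ofReal (B + A ^ μ * B ^ (1 - μ) + B + A ^ μ * B ^ (1 - μ)) := fun t => by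
    rw [eHol0, if_neg hμ.ne', ENNReal.ofReal_add (by positivity) (by positivity),
      ENNReal.ofReal_add (by positivity) (by positivity),
      ENNReal.ofReal_add (by positivity) (by positivity)]
    unfold eOHold eWSup eWHold
    refine add_le_add (add_le_add (add_le_add ?_ ?_) ?_) ?_
    · refine iSup₂_le fun x hx => ENNReal.ofReal_le_ofReal ?_
      rw [hv]
      refine (hsup t x hx).trans ?_
      rw [hB]; nlinarith [mul_nonneg (zero_le_one.trans (h31 σ')) hε0]
    · refine iSup₂_le fun x y => iSup_le fun h => ENNReal.ofReal_le_ofReal ?_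
      have hd : 0 < ‖x - y‖ := norm_pos_iff.2 (sub_ne_zero.2 h.2.2)
      have h1 : ‖v t x - v t y‖ ≤ B := by
        rw [hv, hv]
        refine (norm_sub_le _ _).trans ?_
        linarith [hsup t x h.1, hsup t y h.2.1]
      have h2 : ‖v t x - v t y‖ ≤ A * ‖x - y‖ ^ (1 : ℝ) := by
        rw [hv, hv, Real.rpow_one, hA]
        have h3 := hf.2.1 t x y (Or.inr ⟨h.1, h.2.1⟩)
        have h4 := one_le_three_rpow_mul (one_le_wt2 x y)
          (max_le (wt_le_three h.1) (wt_le_three h.2.1)) (σ + 1)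
        calc ‖f (t, x) - f (t, y)‖
            ≤ (3 ^ |σ + 1| * wt2 x y ^ (σ + 1)) * ‖f (t, x) - f (t, y)‖ :=
              le_mul_of_one_le_left (norm_nonneg _) h4
          _ = 3 ^ |σ + 1| * (wt2 x y ^ (σ + 1) * ‖f (t, x) - f (t, y)‖) := by ring
          _ ≤ 3 ^ |σ + 1| * (C * ‖x - y‖) := by gcongr
          _ = _ := by ring
      simpa using div_rpow_le_interpolation (norm_nonneg _) hA0 hd hμ hμ1 h2 h1
    · refine iSup_le fun x => ENNReal.ofReal_le_ofReal ?_
      rw [hv]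
      exact (hε t x).trans (by linarith)
    · refine iSup₂_le fun x y => iSup_le fun h => ENNReal.ofReal_le_ofReal ?_
      have hd : 0 < ‖x - y‖ := norm_pos_iff.2 (sub_ne_zero.2 h.1)
      have hw := wt2_pos x y
      have hn : Near x y := Or.inl h.2
      have h1 : wt2 x y ^ σ' * ‖v t x - v t y‖ ≤ B := by
        rw [hv, hv]
        have hx := hn.wt2_rpow_le (left_mem_segment ℝ x y) σ'
        have hy := hn.wt2_rpow_le (right_mem_segment ℝ x y) σ'
        calc wt2 x y ^ σ' * ‖f (t, x) - f (t, y)‖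
            ≤ wt2 x y ^ σ' * (‖f (t, x)‖ + ‖f (t, y)‖) := by gcongr; exact norm_sub_le _ _
          _ ≤ 3 ^ |σ'| * wt x ^ σ' * ‖f (t, x)‖ + 3 ^ |σ'| * wt y ^ σ' * ‖f (t, y)‖ := by
              rw [mul_add]; gcongr
          _ = 3 ^ |σ'| * (wt x ^ σ' * ‖f (t, x)‖ + wt y ^ σ' * ‖f (t, y)‖) := by ring
          _ ≤ 3 ^ |σ'| * (ε + ε) := by gcongr; exacts [hε t x, hε t y]
          _ = B := by rw [hB]; ring
      have h2 : wt2 x y ^ σ' * ‖v t x - v t y‖ ≤ A * (‖x - y‖ / wt2 x y) ^ (1 : ℝ) := by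
        rw [hv, hv, Real.rpow_one, ← mul_div_assoc, le_div_iff₀ hw]
        calc wt2 x y ^ σ' * ‖f (t, x) - f (t, y)‖ * wt2 x y
            = wt2 x y ^ (σ' + 1) * ‖f (t, x) - f (t, y)‖ := by
              rw [Real.rpow_add_one hw.ne']; ring
          _ ≤ wt2 x y ^ (σ + 1) * ‖f (t, x) - f (t, y)‖ := by
              gcongr; exact one_le_wt2 x y
          _ ≤ C * ‖x - y‖ := hf.2.1 t x y hn
          _ ≤ A * ‖x - y‖ := by gcongr
      have h3 := div_rpow_le_interpolation (by positivity) hA0 (div_pos hd hw) hμ hμ1 h2 h1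
      rw [div_one, Real.div_rpow hd.le hw.le] at h3
      refine le_of_eq_of_le ?_ h3
      rw [Real.rpow_add hw]
      field_simp
  have htime : ∀ (t₁ t₂ : Set.Icc (0 : ℝ) T) (_ : (t₁ : ℝ) ≠ t₂) (x : Spc n),
      wt x ^ σ' * ‖v t₁ x - v t₂ x‖ / |(t₁ : ℝ) - t₂| ^ (μ / 2) ≤
        A ^ (μ / 2 / θ) * B ^ (1 - μ / 2 / θ) := fun t₁ t₂ h x => by
    have hw := wt_pos x
    refine div_rpow_le_interpolation (by positivity) hA0 (abs_pos.2 (sub_ne_zero.2 h))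
      (half_pos hμ) hθ ?_ ?_
    · rw [hv, hv]
      calc wt x ^ σ' * ‖f (t₁, x) - f (t₂, x)‖ ≤ wt x ^ σ * ‖f (t₁, x) - f (t₂, x)‖ := by
            gcongr; exact one_le_wt x
        _ ≤ C * |(t₁ : ℝ) - t₂| ^ θ := hf.2.2 t₁ t₂ x
        _ ≤ _ := by gcongr
    · rw [hv, hv]
      calc wt x ^ σ' * ‖f (t₁, x) - f (t₂, x)‖ ≤
            wt x ^ σ' * ‖f (t₁, x)‖ + wt x ^ σ' * ‖f (t₂, x)‖ := by
            rw [← mul_add]; gcongr; exact norm_sub_le _ _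
        _ ≤ B := by linarith [hε t₁ x, hε t₂ x]
  rw [eAniso0, if_neg hμ.ne', interpBound, ← hB, ← hA,
    ENNReal.ofReal_add (by positivity) (by positivity)]
  refine add_le_add (iSup_le hspace) ?_
  exact iSup₂_le fun t₁ t₂ => iSup₂_le fun h x => ENNReal.ofReal_le_ofReal (htime t₁ t₂ h x)

end interpolation

section compactness

variable {F : Type*} [NormedAddCommGroup F]

theorem eventually_near (x : Spc n) : ∀ᶠ y in nhds x, Near x y := by
  by_cases hx : x = 0
  · subst hx
    filter_upwards [Metric.closedBall_mem_nhds (0 : Spc n) one_pos] with y hy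
    exact Or.inr ⟨by simp, by simpa using hy⟩
  · filter_upwards [Metric.closedBall_mem_nhds x (half_pos (norm_pos_iff.2 hx))] with y hy
    left
    rw [← dist_eq_norm, dist_comm]
    exact hy

theorem equicontinuous_HB (T C σ : ℝ) {θ : ℝ} (hθ : 0 < θ) :
    Equicontinuous fun (f : {f : Set.Icc (0 : ℝ) T × Spc n → F // HB T C σ θ f}) => f.1 := by
  rintro ⟨t₀, x₀⟩
  refine Metric.equicontinuousAt_of_continuity_modulus
    (fun p => (wt2 x₀ p.2 ^ (σ + 1))⁻¹ * (C * ‖x₀ - p.2‖) +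
      (wt p.2 ^ σ)⁻¹ * (C * |(t₀ : ℝ) - p.1| ^ θ)) ?_ _ ?_
  · have h1 : Continuous fun p : Set.Icc (0 : ℝ) T × Spc n => (wt2 x₀ p.2 ^ (σ + 1))⁻¹ :=
      Continuous.inv₀ (Continuous.rpow_const
        (continuous_const.max (continuous_wt.comp continuous_snd))
        fun p => Or.inl (wt2_pos x₀ p.2).ne')
        fun p => (Real.rpow_pos_of_pos (wt2_pos x₀ p.2) _).ne'
    have h2 : Continuous fun p : Set.Icc (0 : ℝ) T × Spc n => (wt p.2 ^ σ)⁻¹ :=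
      Continuous.inv₀ ((continuous_wt_rpow σ).comp continuous_snd)
        fun p => (Real.rpow_pos_of_pos (wt_pos p.2) _).ne'
    have h3 : Continuous fun p : Set.Icc (0 : ℝ) T × Spc n => |(t₀ : ℝ) - p.1| ^ θ :=
      Continuous.rpow_const (by fun_prop) fun _ => Or.inr hθ.le
    have h4 : Continuous fun p : Set.Icc (0 : ℝ) T × Spc n =>
      (wt2 x₀ p.2 ^ (σ + 1))⁻¹ * (C * ‖x₀ - p.2‖) +
        (wt p.2 ^ σ)⁻¹ * (C * |(t₀ : ℝ) - p.1| ^ θ) := by fun_prop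
    simpa [Real.zero_rpow hθ.ne'] using h4.tendsto (t₀, x₀)
  · filter_upwards [continuous_snd.continuousAt.eventually (eventually_near x₀)] with p hp f
    refine (dist_triangle _ (f.1 (t₀, p.2)) _).trans (add_le_add ?_ ?_)
    · rw [dist_eq_norm, le_inv_mul_iff₀ (Real.rpow_pos_of_pos (wt2_pos x₀ p.2) _)]
      exact f.2.2.1 t₀ x₀ p.2 hp
    · rw [dist_eq_norm, le_inv_mul_iff₀ (Real.rpow_pos_of_pos (wt_pos p.2) _)]
      exact f.2.2.2 t₀ p.1 p.2

theorem isClosed_HB (T C σ θ : ℝ) :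
    IsClosed {f : Set.Icc (0 : ℝ) T × Spc n → F | HB T C σ θ f} := by
  simp only [HB, Set.ofPred_and, Set.ofPred_forall]
  refine .inter ?_ (.inter ?_ ?_)
  · exact isClosed_iInter fun t => isClosed_iInter fun x =>
      isClosed_le (by fun_prop) continuous_const
  · exact isClosed_iInter fun t => isClosed_iInter fun x => isClosed_iInter fun y =>
      isClosed_iInter fun h => isClosed_le (by fun_prop) continuous_const
  · exact isClosed_iInter fun t => isClosed_iInter fun x => isClosed_iInter fun y =>
      isClosed_le (by fun_prop) continuous_const

theorem isCompact_HB [ProperSpace F] (T C σ : ℝ) {θ : ℝ} (hθ : 0 < θ) :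
    IsCompact {f : C(Set.Icc (0 : ℝ) T × Spc n, F) | HB T C σ θ f} := by
  refine ArzelaAscoli.isCompact_of_equicontinuous _ ?_ ?_
  · have himage : ContinuousMap.toFun '' {f : C(Set.Icc (0 : ℝ) T × Spc n, F) | HB T C σ θ f} =
        {f | HB T C σ θ f} := by
      ext f
      constructor
      · rintro ⟨g, hg, rfl⟩; exact hg
      · intro hf
        exact ⟨⟨f, (equicontinuous_HB T C σ hθ).continuous ⟨f, hf⟩⟩, hf, rfl⟩
    rw [himage]
    refine (isCompact_univ_pi fun p : Set.Icc (0 : ℝ) T × Spc n =>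
      isCompact_closedBall (0 : F) ((wt p.2 ^ σ)⁻¹ * C)).of_isClosed_subset
        (isClosed_HB T C σ θ) fun f hf p _ => ?_
    rw [mem_closedBall_zero_iff, le_inv_mul_iff₀ (Real.rpow_pos_of_pos (wt_pos p.2) _)]
    exact hf.1 p.1 p.2
  · exact (equicontinuous_HB T C σ hθ).comp
      fun f : {f : C(Set.Icc (0 : ℝ) T × Spc n, F) | HB T C σ θ f} => ⟨f.1, f.2⟩

/-- Arzelà–Ascoli simultaneously for countably many sequences. -/
theorem exists_subseq_of_HB {ι : Type*} [Countable ι] {F : ι → Type*}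
    [∀ q, NormedAddCommGroup (F q)] [∀ q, ProperSpace (F q)] (T : ℝ) (C σ : ι → ℝ) {θ : ℝ}
    (hθ : 0 < θ) (U : ℕ → ∀ q, C(Set.Icc (0 : ℝ) T × Spc n, F q))
    (hU : ∀ m q, HB T (C q) (σ q) θ (U m q)) :
    ∃ φ : ℕ → ℕ, StrictMono φ ∧ ∃ V : ∀ q, C(Set.Icc (0 : ℝ) T × Spc n, F q),
      ∀ q, Tendsto (fun m => U (φ m) q) atTop (nhds (V q)) := by
  obtain ⟨V, -, φ, hφ, hV⟩ := (isCompact_univ_pi fun q =>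
    isCompact_HB (n := n) (F := F q) T (C q) (σ q) hθ).tendsto_subseq
    (x := U) fun m q _ => hU m q
  exact ⟨φ, hφ, V, fun q => tendsto_pi_nhds.1 hV q⟩

theorem HB.of_tendsto {T C σ θ : ℝ} {f : ℕ → C(Set.Icc (0 : ℝ) T × Spc n, F)}
    {V : C(Set.Icc (0 : ℝ) T × Spc n, F)} (hf : ∀ m, HB T C σ θ (f m))
    (h : Tendsto f atTop (nhds V)) : HB T C σ θ V :=
  (isClosed_HB T C σ θ).mem_of_tendsto
    (tendsto_pi_nhds.2 fun p => ((continuous_eval_const p).tendsto V).comp h)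
    (Eventually.of_forall hf)

/-- Locally uniform convergence together with a uniform weighted bound yields uniform convergence
for any weaker weight. -/
theorem eventually_weighted_le {T C σ σ' θ ε : ℝ} {f : ℕ → C(Set.Icc (0 : ℝ) T × Spc n, F)}
    {V : C(Set.Icc (0 : ℝ) T × Spc n, F)} (hT : 0 ≤ T) (hf : ∀ m, HB T C σ θ (f m))
    (h : Tendsto f atTop (nhds V)) (hσ : σ' < σ) (hε : 0 < ε) :
    ∀ᶠ m in atTop, ∀ t x, wt x ^ σ' * ‖f m (t, x) - V (t, x)‖ ≤ ε := by
  have hV := HB.of_tendsto hf h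
  have hC : 0 ≤ C := hV.nonneg hT
  obtain ⟨R, hR1, hR⟩ : ∃ R : ℝ, 1 ≤ R ∧ ∀ r, R ≤ r → r ^ (σ' - σ) * (C + C) ≤ ε := by
    have h1 : Tendsto (fun r : ℝ => r ^ (σ' - σ) * (C + C)) atTop (nhds (0 * (C + C))) := by
      refine Tendsto.mul_const _ ?_
      simpa using tendsto_rpow_neg_atTop (sub_pos.2 hσ)
    rw [zero_mul] at h1
    obtain ⟨R, hR⟩ := eventually_atTop.1 (h1.eventually_le_const hε)
    exact ⟨max R 1, le_max_right _ _, fun r hr => hR r ((le_max_left _ _).trans hr)⟩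
  set K : Set (Set.Icc (0 : ℝ) T × Spc n) := Set.univ ×ˢ Metric.closedBall 0 R with hK
  have hKc : IsCompact K := isCompact_univ.prod (isCompact_closedBall 0 R)
  have hu := (ContinuousMap.tendsto_iff_forall_isCompact_tendstoUniformlyOn.1 h) K hKc
  rw [Metric.tendstoUniformlyOn_iff] at hu
  obtain ⟨M, hM⟩ := (isCompact_closedBall (0 : Spc n) R).exists_bound_of_continuousOn
    (continuous_wt_rpow σ').continuousOn
  have hM0 : 0 < max M 1 := by positivity
  filter_upwards [hu (ε / max M 1) (by positivity)] with m hm t x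
  by_cases hx : ‖x‖ ≤ R
  · have h1 := hm (t, x) ⟨Set.mem_univ _, by simpa using hx⟩
    have h2 := hM x (by simpa using hx)
    rw [dist_comm, dist_eq_norm] at h1
    calc wt x ^ σ' * ‖f m (t, x) - V (t, x)‖ ≤ max M 1 * (ε / max M 1) := by
          gcongr
          exact (le_abs_self _).trans (h2.trans (le_max_left _ _))
      _ = ε := by field_simp
  · have h1 := ((hf m).sub hV).1 t x
    have h2 := hR (wt x) ((not_le.1 hx).le.trans (norm_le_wt x))
    calc wt x ^ σ' * ‖f m (t, x) - V (t, x)‖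
        = wt x ^ (σ' - σ) * (wt x ^ σ * ‖f m (t, x) - V (t, x)‖) := by
          rw [← mul_assoc, ← Real.rpow_add (wt_pos x)]; simp
      _ ≤ wt x ^ (σ' - σ) * (C + C) := by
          have := wt_pos x
          gcongr
          exact h1
      _ ≤ ε := h2

theorem tendsto_eAniso0_of_HB {T C σ σ' θ μ : ℝ} {f : ℕ → C(Set.Icc (0 : ℝ) T × Spc n, F)}
    {V : C(Set.Icc (0 : ℝ) T × Spc n, F)} (hT : 0 ≤ T) (hf : ∀ m, HB T C σ θ (f m))
    (h : Tendsto f atTop (nhds V)) (hσ : σ' < σ) (hμ : 0 < μ) (hμ1 : μ < 1) (hθ : μ / 2 < θ)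
    {v : ℕ → ℝ → Spc n → F}
    (hv : ∀ m (t : Set.Icc (0 : ℝ) T) x, v m t x = f m (t, x) - V (t, x)) :
    Tendsto (fun m => eAniso0 T μ σ' (v m)) atTop (nhds 0) := by
  have hV := HB.of_tendsto hf h
  rw [ENNReal.tendsto_nhds_zero]
  intro δ hδ
  have h1 : Tendsto (fun ε => ENNReal.ofReal (interpBound (C + C) σ σ' θ μ ε)) (nhds 0)
      (nhds 0) := by
    simpa using ENNReal.tendsto_ofReal (tendsto_interpBound (C + C) σ σ' hμ hμ1 hθ)
  have h2 := ENNReal.tendsto_nhds_zero.1 h1 δ hδ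
  obtain ⟨ε, hε, hε0⟩ := ((h2.filter_mono nhdsWithin_le_nhds).and
    (self_mem_nhdsWithin : Set.Ioi (0 : ℝ) ∈ nhdsWithin 0 (Set.Ioi 0))).exists
  filter_upwards [eventually_weighted_le hT hf h hσ hε0] with m hm
  exact (HB.eAniso0_le ((hf m).sub hV) hT hσ.le hμ hμ1 hθ hm (hv m)).trans hε

theorem HB.eAniso0_ne_top {T C σ σ' θ μ : ℝ} {f : Set.Icc (0 : ℝ) T × Spc n → F}
    (hf : HB T C σ θ f) (hT : 0 ≤ T) (hσ : σ' ≤ σ) (hμ : 0 < μ) (hμ1 : μ < 1) (hθ : μ / 2 < θ)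
    {v : ℝ → Spc n → F} (hv : ∀ (t : Set.Icc (0 : ℝ) T) x, v t x = f (t, x)) :
    eAniso0 T μ σ' v ≠ ⊤ := by
  refine ne_top_of_le_ne_top ENNReal.ofReal_ne_top
    (hf.eAniso0_le hT hσ hμ hμ1 hθ (ε := C) (fun t x => le_trans ?_ (hf.1 t x)) hv)
  gcongr
  exact one_le_wt x

end compactness

section jets

/-- The space of `p`-th order spatial derivatives at a point. -/
abbrev Jt (n p : ℕ) := ContinuousMultilinearMap ℝ (fun _ : Fin p => Spc n) ℝ

instance (p : ℕ) : ProperSpace (Jt n p) := by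
  have : FiniteDimensional ℝ (Jt n p) := Module.Finite.of_injective
    (ContinuousMultilinearMap.toMultilinearMapLinear :
      Jt n p →ₗ[ℝ] MultilinearMap ℝ (fun _ : Fin p => Spc n) ℝ)
    ContinuousMultilinearMap.toMultilinearMap_injective
  exact FiniteDimensional.proper ℝ _

theorem map_intervalIntegral {G H : Type*} [NormedAddCommGroup G]
    [NormedSpace ℝ G] [CompleteSpace G] [NormedAddCommGroup H] [NormedSpace ℝ H] [CompleteSpace H]
    (L : G ≃ₗᵢ[ℝ] H) {f : ℝ → G} (hf : Continuous f) (a b : ℝ) :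
    L (∫ τ in a..b, f τ) = ∫ τ in a..b, L (f τ) :=
  (L.toContinuousLinearEquiv.toContinuousLinearMap.intervalIntegral_comp_comm
    (hf.intervalIntegrable a b)).symm

/-- Currying in the first variable. -/
def curryL (n p : ℕ) : Jt n (p + 1) ≃ₗᵢ[ℝ] Spc n →L[ℝ] Jt n p :=
  continuousMultilinearCurryLeftEquiv ℝ (fun _ : Fin (p + 1) => Spc n) ℝ

theorem curryL_intervalIntegral {p : ℕ} {f : ℝ → Jt n (p + 1)} (hf : Continuous f) (a b : ℝ) :
    curryL n p (∫ τ in a..b, f τ) = ∫ τ in a..b, curryL n p (f τ) :=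
  map_intervalIntegral (G := Jt n (p + 1)) (H := Spc n →L[ℝ] Jt n p)
    (curryL n p) hf a b

theorem hasFDerivAt_intervalIntegral {E G : Type*} [NormedAddCommGroup E] [NormedSpace ℝ E]
    [ProperSpace E] [NormedAddCommGroup G] [NormedSpace ℝ G] {g : ℝ × E → G}
    {g' : ℝ × E → E →L[ℝ] G} (hg : Continuous g) (hg' : Continuous g')
    (h : ∀ τ x, HasFDerivAt (fun y => g (τ, y)) (g' (τ, x)) x) (a b : ℝ) (x : E) :
    HasFDerivAt (fun y => ∫ τ in a..b, g (τ, y)) (∫ τ in a..b, g' (τ, x)) x := by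
  obtain ⟨M, hM⟩ := (isCompact_uIcc.prod (isCompact_closedBall x 1)).exists_bound_of_continuousOn
    (f := g') (s := Set.uIcc a b ×ˢ Metric.closedBall x 1) hg'.continuousOn
  refine intervalIntegral.hasFDerivAt_integral_of_dominated_of_fderiv_le
    (F := fun y τ => g (τ, y)) (F' := fun y τ => g' (τ, y)) (bound := fun _ => M)
    (Metric.closedBall_mem_nhds x one_pos) (Eventually.of_forall fun y => ?_) ?_ ?_ ?_ ?_ ?_
  · exact (hg.comp (by fun_prop)).aestronglyMeasurable
  · exact (hg.comp (by fun_prop)).intervalIntegrable _ _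
  · exact (hg'.comp (by fun_prop)).aestronglyMeasurable
  · exact Eventually.of_forall fun τ hτ y hy => hM (τ, y) ⟨Set.uIoc_subset_uIcc hτ, hy⟩
  · exact intervalIntegrable_const
  · exact Eventually.of_forall fun τ _ y _ => h τ y

/-- A family of functions on `[0,T] × ℝⁿ` that behaves like the family of mixed derivatives
`∂_x^p ∂_t^j` for `j ≤ S` and `p + 2 j ≤ N`, with time derivatives in integrated form. -/
structure IsJet {T : ℝ} (hT : 0 ≤ T) (N S : ℕ)
    (D : ∀ p : ℕ, ℕ → Set.Icc (0 : ℝ) T × Spc n → Jt n p) : Prop where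
  cont : ∀ p j, j ≤ S → p + 2 * j ≤ N → Continuous (D p j)
  space : ∀ p j, j ≤ S → p + 1 + 2 * j ≤ N → ∀ t x,
    HasFDerivAt (fun y => D p j (t, y)) (D (p + 1) j (t, x)).curryLeft x
  time : ∀ p j, j + 1 ≤ S → p + 2 * (j + 1) ≤ N → ∀ t x,
    D p j (t, x) = D p j (⟨0, Set.left_mem_Icc.2 hT⟩, x) +
      ∫ τ in (0 : ℝ)..t, D p (j + 1) (Set.projIcc 0 T hT τ, x)

theorem IsJet.of_time_zero {T : ℝ} (hT : 0 ≤ T) {N S : ℕ}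
    {D : ∀ p : ℕ, ℕ → Set.Icc (0 : ℝ) T × Spc n → Jt n p}
    (cont : ∀ p j, j ≤ S → p + 2 * j ≤ N → Continuous (D p j))
    (space : ∀ p j, j ≤ S → p + 1 + 2 * j ≤ N → ∀ t x,
      HasFDerivAt (fun y => D p j (t, y)) (D (p + 1) j (t, x)).curryLeft x)
    (time : ∀ j, j + 1 ≤ S → 2 * (j + 1) ≤ N → ∀ t x,
      D 0 j (t, x) = D 0 j (⟨0, Set.left_mem_Icc.2 hT⟩, x) +
        ∫ τ in (0 : ℝ)..t, D 0 (j + 1) (Set.projIcc 0 T hT τ, x)) :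
    IsJet hT N S D := by
  refine ⟨cont, space, fun p j hj => ?_⟩
  have hproj : Continuous fun q : ℝ × Spc n => (Set.projIcc 0 T hT q.1, q.2) :=
    (continuous_projIcc.comp continuous_fst).prodMk continuous_snd
  induction p with
  | zero => intro hN; exact time j hj (by omega)
  | succ p ih =>
    intro hN t x
    have hc1 := (cont p (j + 1) hj (by omega)).comp hproj
    have hc2 := (cont (p + 1) (j + 1) hj (by omega)).comp hproj
    have key := (space p j (by omega) (by omega) ⟨0, Set.left_mem_Icc.2 hT⟩ x).add
      (hasFDerivAt_intervalIntegral hc1 ((curryL n p).continuous.comp hc2)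
        (fun τ x => space p (j + 1) hj (by omega) (Set.projIcc 0 T hT τ) x) 0 t x)
    have key2 := (space p j (by omega) (by omega) t x).unique
      (key.congr_of_eventuallyEq (Eventually.of_forall fun y => ih (by omega) t y))
    apply (curryL n p).injective
    have hc3 : Continuous fun τ : ℝ => D (p + 1) (j + 1) (Set.projIcc 0 T hT τ, x) :=
      hc2.comp (by fun_prop : Continuous fun τ : ℝ => (τ, x))
    rw [map_add, curryL_intervalIntegral hc3]
    exact key2

theorem IsJet.of_tendsto {T : ℝ} {hT : 0 ≤ T} {N S : ℕ}
    {D : ℕ → ∀ p : ℕ, ℕ → Set.Icc (0 : ℝ) T × Spc n → Jt n p}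
    (hD : ∀ m, IsJet hT N S (D m))
    {V : ∀ p : ℕ, ℕ → Set.Icc (0 : ℝ) T × Spc n → Jt n p}
    (hV : ∀ p j, j ≤ S → p + 2 * j ≤ N → Continuous (V p j))
    (h : ∀ p j, j ≤ S → p + 2 * j ≤ N →
      TendstoLocallyUniformly (fun m => D m p j) (V p j) atTop) :
    IsJet hT N S V := by
  have hpt : ∀ p j, j ≤ S → p + 2 * j ≤ N → ∀ q,
      Tendsto (fun m => D m p j q) atTop (nhds (V p j q)) := fun p j hj hN q =>
    (tendstoLocallyUniformlyOn_univ.2 (h p j hj hN)).tendsto_at (Set.mem_univ q)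
  refine ⟨hV, fun p j hj hN t x => ?_, fun p j hj hN t x => ?_⟩
  · have hu : TendstoLocallyUniformlyOn (fun m y => curryL n p (D m (p + 1) j (t, y)))
        (fun y => curryL n p (V (p + 1) j (t, y))) atTop Set.univ := by
      rw [tendstoLocallyUniformlyOn_univ]
      exact (curryL n p).isometry.uniformContinuous.comp_tendstoLocallyUniformly
        ((h (p + 1) j hj (by omega)).comp (fun y => (t, y)) (by fun_prop))
    exact hasFDerivAt_of_tendstoLocallyUniformlyOn isOpen_univ hu
      (fun m y _ => (hD m).space p j hj hN t y) (fun y _ => hpt p j hj (by omega) (t, y))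
      (Set.mem_univ x)
  · have hc := ((hV p (j + 1) hj hN).comp (by fun_prop :
      Continuous fun s : Set.Icc (0 : ℝ) T => (s, x)))
    have hint : Tendsto (fun m => ∫ τ in (0 : ℝ)..t, D m p (j + 1) (Set.projIcc 0 T hT τ, x)) atTop
        (nhds (∫ τ in (0 : ℝ)..t, V p (j + 1) (Set.projIcc 0 T hT τ, x))) := by
      have hu : TendstoUniformly (fun m (s : Set.Icc (0 : ℝ) T) => D m p (j + 1) (s, x))
          (fun s => V p (j + 1) (s, x)) atTop := by
        rw [← tendstoLocallyUniformly_iff_tendstoUniformly_of_compactSpace]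
        exact (h p (j + 1) hj hN).comp (fun s => (s, x)) (by fun_prop)
      obtain ⟨M, hM⟩ := (isCompact_range hc).isBounded.exists_norm_le
      refine intervalIntegral.tendsto_integral_filter_of_dominated_convergence (fun _ => M + 1)
        (Eventually.of_forall fun m => ?_) ?_ intervalIntegrable_const
        (Eventually.of_forall fun τ _ => hpt p (j + 1) hj hN _)
      · exact (((hD m).cont p (j + 1) hj hN).comp
          (continuous_projIcc.prodMk continuous_const)).aestronglyMeasurable
      · filter_upwards [Metric.tendstoUniformly_iff.1 hu 1 one_pos] with m hm
        refine Eventually.of_forall fun τ _ => ?_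
        have h1 := hm (Set.projIcc 0 T hT τ)
        have h2 := hM _ ⟨Set.projIcc 0 T hT τ, rfl⟩
        rw [dist_comm, dist_eq_norm] at h1
        have h3 := norm_le_norm_add_norm_sub' (D m p (j + 1) (Set.projIcc 0 T hT τ, x))
          (V p (j + 1) (Set.projIcc 0 T hT τ, x))
        simp only [Function.comp] at h2
        linarith
    exact tendsto_nhds_unique (hpt p j (by omega) (by omega) (t, x))
      (((hpt p j (by omega) (by omega) _).add hint).congr fun m =>
        ((hD m).time p j hj hN t x).symm)

end jets

section mixed

theorem cast_exponent (s j k : ℕ) :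
    (2 * ((s : WithTop ℕ∞) - j) + k) = ((2 * (s - j) + k : ℕ) : WithTop ℕ∞) := by
  push_cast
  rfl

theorem AnisoReg.contDiff {T : ℝ} {K s : ℕ} {u : ℝ → Spc n → ℝ} (hu : AnisoReg T K s u)
    {p j : ℕ} (hj : j ≤ s) (hp : p + 2 * j ≤ 2 * s + K) {t : ℝ} (ht : t ∈ Set.Icc 0 T) :
    ContDiff ℝ p fun x => tDeriv T j u t x := by
  have h := hu.2.1 j hj t ht
  rw [cast_exponent] at h
  exact h.of_le (by exact_mod_cast (by omega : p ≤ 2 * (s - j) + K))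

/-- The identification of zeroth order derivatives with values. -/
def curryZ (n : ℕ) : Jt n 0 ≃ₗᵢ[ℝ] ℝ := continuousMultilinearCurryFin0 ℝ (Spc n) ℝ

theorem curryZ_mixDeriv (T : ℝ) (j : ℕ) (u : ℝ → Spc n → ℝ) (t : ℝ) (x : Spc n) :
    curryZ n (mixDeriv T 0 j u t x) = tDeriv T j u t x :=
  (curryZ n).apply_symm_apply _

theorem curryZ_intervalIntegral {f : ℝ → Jt n 0} (hf : Continuous f) (a b : ℝ) :
    curryZ n (∫ τ in a..b, f τ) = ∫ τ in a..b, curryZ n (f τ) :=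
  map_intervalIntegral (G := Jt n 0) (H := ℝ) (curryZ n) hf a b

/-- The mixed derivatives of `u`, as functions on `[0,T] × ℝⁿ`. -/
def mixJet (T : ℝ) (u : ℝ → Spc n → ℝ) (p j : ℕ) (q : Set.Icc (0 : ℝ) T × Spc n) : Jt n p :=
  mixDeriv T p j u q.1 q.2

theorem AnisoReg.isJet {T : ℝ} (hT : 0 < T) {K s : ℕ} {u : ℝ → Spc n → ℝ}
    (hu : AnisoReg T K s u) : IsJet hT.le (2 * s + K) s (mixJet T u) := by
  refine IsJet.of_time_zero hT.le (fun p j hj hp => hu.2.2 j p hj hp) ?_ ?_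
  · intro p j hj hp t x
    exact (hu.contDiff hj hp t.2).ftaylorSeries.fderiv p (by exact_mod_cast Nat.lt_succ_self p) x
  · intro j hj hp t x
    have hcont : Continuous fun τ : ℝ => mixJet T u 0 (j + 1) (Set.projIcc 0 T hT.le τ, x) :=
      (hu.2.2 (j + 1) 0 hj (by omega)).comp
        (f := fun τ : ℝ => (Set.projIcc 0 T hT.le τ, x))
        (continuous_projIcc.prodMk continuous_const)
    have hdiff : ∀ τ ∈ Set.Icc 0 T, HasDerivWithinAt (fun τ => tDeriv T j u τ x)
        (tDeriv T (j + 1) u τ x) (Set.Icc 0 T) τ := by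
      intro τ hτ
      have := ((hu.1 x).differentiableOn_iteratedDerivWithin
        (by exact_mod_cast hj : (j : WithTop ℕ∞) < s) (uniqueDiffOn_Icc hT)) τ hτ
      have h2 := this.hasDerivWithinAt
      rw [← iteratedDerivWithin_succ] at h2
      exact h2
    apply (curryZ n).injective
    rw [map_add, curryZ_intervalIntegral hcont]
    simp only [mixJet, curryZ_mixDeriv] at hcont ⊢
    rw [← sub_eq_iff_eq_add', ← intervalIntegral.integral_eq_sub_of_hasDerivAt_of_le t.2.1
      (f := fun τ => tDeriv T j u τ x)]
    · intro τ hτ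
      have hsub : Set.Icc 0 (t : ℝ) ⊆ Set.Icc 0 T := Set.Icc_subset_Icc_right t.2.2
      exact (hdiff τ (hsub hτ)).continuousWithinAt.mono hsub
    · intro τ hτ
      have hτ' : τ ∈ Set.Ioo 0 T := ⟨hτ.1, hτ.2.trans_le t.2.2⟩
      have := (hdiff τ (Set.Ioo_subset_Icc_self hτ')).hasDerivAt (Icc_mem_nhds hτ'.1 hτ'.2)
      rwa [Set.projIcc_of_mem hT.le (Set.Ioo_subset_Icc_self hτ')]
    · refine Continuous.intervalIntegrable ?_ _ _
      simpa only [Function.comp_def, curryZ_mixDeriv] using (curryZ n).continuous.comp hcont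

/-- The function underlying a jet, extended to all times. -/
def jetFun {T : ℝ} (hT : 0 ≤ T) (V : ∀ p : ℕ, ℕ → Set.Icc (0 : ℝ) T × Spc n → Jt n p)
    (t : ℝ) (x : Spc n) : ℝ :=
  curryZ n (V 0 0 (Set.projIcc 0 T hT t, x))

variable {T : ℝ} (hT : 0 < T) {K S : ℕ} {V : ∀ p : ℕ, ℕ → Set.Icc (0 : ℝ) T × Spc n → Jt n p}

theorem IsJet.hasDerivWithinAt (hV : IsJet hT.le (2 * S + K) S V) {j : ℕ} (hj : j + 1 ≤ S)
    (x : Spc n) {t : ℝ} (ht : t ∈ Set.Icc 0 T) :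
    HasDerivWithinAt (fun τ => curryZ n (V 0 j (Set.projIcc 0 T hT.le τ, x)))
      (curryZ n (V 0 (j + 1) (Set.projIcc 0 T hT.le t, x))) (Set.Icc 0 T) t := by
  have hc : Continuous fun τ : ℝ => V 0 (j + 1) (Set.projIcc 0 T hT.le τ, x) :=
    (hV.cont 0 (j + 1) hj (by omega)).comp
      (f := fun τ : ℝ => (Set.projIcc 0 T hT.le τ, x))
      (continuous_projIcc.prodMk continuous_const)
  have h := ((((curryZ n).continuous.comp hc).integral_hasStrictDerivAt 0 t
    ).hasDerivAt.hasDerivWithinAt (s := Set.Icc 0 T)).const_add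
      (curryZ n (V 0 j (⟨0, Set.left_mem_Icc.2 hT.le⟩, x)))
  refine h.congr_of_mem (fun τ hτ => ?_) ht
  rw [Set.projIcc_of_mem hT.le hτ, hV.time 0 j hj (by omega) ⟨τ, hτ⟩ x, map_add,
    curryZ_intervalIntegral hc]
  rfl

theorem IsJet.tDeriv_jetFun (hV : IsJet hT.le (2 * S + K) S V) {j : ℕ} (hj : j ≤ S) (x : Spc n) :
    Set.EqOn (fun t => tDeriv T j (jetFun hT.le V) t x)
      (fun t => curryZ n (V 0 j (Set.projIcc 0 T hT.le t, x))) (Set.Icc 0 T) := by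
  induction j with
  | zero => intro t _; simp [tDeriv, jetFun]
  | succ j ih =>
    intro t ht
    have hsucc : tDeriv T (j + 1) (jetFun hT.le V) t x =
        derivWithin (fun τ => tDeriv T j (jetFun hT.le V) τ x) (Set.Icc 0 T) t := by
      simp only [tDeriv, iteratedDerivWithin_succ]
    simp only [hsucc]
    rw [derivWithin_congr (ih (by omega)) (ih (by omega) ht)]
    exact (hV.hasDerivWithinAt hT hj x ht).derivWithin (uniqueDiffOn_Icc hT t ht)

theorem IsJet.hasFTaylorSeriesUpTo (hV : IsJet hT.le (2 * S + K) S V) {j : ℕ} (hj : j ≤ S)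
    {t : ℝ} (ht : t ∈ Set.Icc 0 T) :
    HasFTaylorSeriesUpTo ((2 * (S - j) + K : ℕ) : ℕ∞) (fun x => tDeriv T j (jetFun hT.le V) t x)
      fun x p => V p j (⟨t, ht⟩, x) := by
  refine ⟨fun x => ?_, fun p hp x => ?_, fun p hp => ?_⟩
  · have := hV.tDeriv_jetFun hT hj x ht
    simp only [Set.projIcc_of_mem hT.le ht] at this
    rw [this]
    rfl
  · have hp' : p < 2 * (S - j) + K := by exact_mod_cast hp
    exact hV.space p j hj (by omega) _ x
  · have hp' : p ≤ 2 * (S - j) + K := by exact_mod_cast hp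
    exact (hV.cont p j hj (by omega)).comp (by fun_prop)

theorem IsJet.mixDeriv_jetFun (hV : IsJet hT.le (2 * S + K) S V) {p j : ℕ} (hj : j ≤ S)
    (hp : p + 2 * j ≤ 2 * S + K) (t : Set.Icc 0 T) (x : Spc n) :
    mixDeriv T p j (jetFun hT.le V) t x = V p j (t, x) :=
  ((hV.hasFTaylorSeriesUpTo hT hj t.2).eq_iteratedFDeriv
    (by exact_mod_cast (by omega : p ≤ 2 * (S - j) + K)) x).symm

theorem IsJet.anisoReg (hV : IsJet hT.le (2 * S + K) S V) : AnisoReg T K S (jetFun hT.le V) := by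
  refine ⟨fun x => ?_, fun j hj t ht => ?_, fun j p hj hp => ?_⟩
  · rw [contDiffOn_nat_iff_continuousOn_differentiableOn_deriv (uniqueDiffOn_Icc hT)]
    refine ⟨fun j hj => ?_, fun j hj => ?_⟩
    · refine ContinuousOn.congr (Continuous.continuousOn ?_) (hV.tDeriv_jetFun hT hj x)
      exact (curryZ n).continuous.comp ((hV.cont 0 j hj (by omega)).comp
        (f := fun τ : ℝ => (Set.projIcc 0 T hT.le τ, x))
        (continuous_projIcc.prodMk continuous_const))
    · exact DifferentiableOn.congr
        (fun t ht => (hV.hasDerivWithinAt hT hj x ht).differentiableWithinAt)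
        (hV.tDeriv_jetFun hT hj.le x)
  · rw [cast_exponent]
    exact (hV.hasFTaylorSeriesUpTo hT hj ht).contDiff
  · exact (hV.cont p j hj hp).congr fun q => (hV.mixDeriv_jetFun hT hj hp q.1 q.2).symm

end mixed

section bounds

theorem eAniso0_le_eAnisoKS (T : ℝ) {K s : ℕ} (lam δ : ℝ) (u : ℝ → Spc n → ℝ) {p j : ℕ}
    (hj : j ≤ s) (hp : p + 2 * j ≤ 2 * s + K) :
    eAniso0 T lam (δ + p) (mixDeriv T p j u) ≤ eAnisoKS T K s lam δ u := by
  obtain ⟨b, m, rfl, hb, hm⟩ : ∃ b m, p = b + m ∧ b ≤ K ∧ m + 2 * j ≤ 2 * s :=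
    ⟨min p K, p - min p K, by omega, by omega, by omega⟩
  have h1 := Finset.single_le_sum (f := fun j : ℕ => if m + 2 * j ≤ 2 * s then
    eAniso0 T lam (δ + b + m) (mixDeriv T (b + m) j u) else 0) (fun _ _ => zero_le)
    (Finset.mem_range.2 (by omega : j < s + 1))
  have h2 := Finset.single_le_sum (f := fun m : ℕ => ∑ j ∈ Finset.range (s + 1),
    if m + 2 * j ≤ 2 * s then
    eAniso0 T lam (δ + b + m) (mixDeriv T (b + m) j u) else 0) (fun _ _ => zero_le)
    (Finset.mem_range.2 (by omega : m < 2 * s + 1))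
  have h3 := Finset.single_le_sum (f := fun b : ℕ => ∑ m ∈ Finset.range (2 * s + 1),
    ∑ j ∈ Finset.range (s + 1), if m + 2 * j ≤ 2 * s then
    eAniso0 T lam (δ + b + m) (mixDeriv T (b + m) j u) else 0) (fun _ _ => zero_le)
    (Finset.mem_range.2 (by omega : b < K + 1))
  simp only [if_pos hm] at h1
  push_cast
  rw [← add_assoc]
  exact h1.trans (h2.trans h3)

section pointwise

variable {F : Type*} [NormedAddCommGroup F] {T lam σ : ℝ} {C : ℝ≥0∞} {v : ℝ → Spc n → F}

theorem weighted_norm_le_of_eAniso0_le (hlam : lam ≠ 0) (hC : C ≠ ⊤) (h : eAniso0 T lam σ v ≤ C)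
    (t : Set.Icc (0 : ℝ) T) (x : Spc n) : wt x ^ σ * ‖v t x‖ ≤ C.toReal := by
  refine (ENNReal.ofReal_le_iff_le_toReal hC).1 (le_trans ?_ h)
  refine le_trans ?_ le_self_add
  refine le_trans ?_ (le_iSup (fun t : Set.Icc (0 : ℝ) T => eHol0 lam σ (v t)) t)
  rw [eHol0, if_neg hlam]
  refine le_trans ?_ le_self_add
  refine le_trans ?_ le_add_self
  exact le_iSup (fun x => ENNReal.ofReal (wt x ^ σ * ‖v t x‖)) x

theorem weighted_norm_sub_le_of_eAniso0_le (hlam : 0 < lam) (hC : C ≠ ⊤)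
    (h : eAniso0 T lam σ v ≤ C) (t₁ t₂ : Set.Icc (0 : ℝ) T) (x : Spc n) :
    wt x ^ σ * ‖v t₁ x - v t₂ x‖ ≤ C.toReal * |(t₁ : ℝ) - t₂| ^ (lam / 2) := by
  by_cases ht : (t₁ : ℝ) = t₂
  · rw [ht]
    simp only [sub_self, norm_zero, mul_zero, abs_zero]
    positivity
  rw [← div_le_iff₀ (Real.rpow_pos_of_pos (abs_pos.2 (sub_ne_zero.2 ht)) _)]
  refine (ENNReal.ofReal_le_iff_le_toReal hC).1 (le_trans ?_ h)
  refine le_trans ?_ le_add_self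
  rw [if_neg hlam.ne']
  exact le_iSup_of_le t₁ (le_iSup_of_le t₂ (le_iSup_of_le ht (le_iSup_of_le x le_rfl)))

end pointwise

variable {T : ℝ} {hT : 0 ≤ T} {N s : ℕ} {D : ∀ p : ℕ, ℕ → Set.Icc (0 : ℝ) T × Spc n → Jt n p}

theorem IsJet.hb (hD : IsJet hT N s D) {p j : ℕ} (hj : j ≤ s) (hp : p + 1 + 2 * j ≤ N)
    {C σ θ : ℝ} (h0 : ∀ t x, wt x ^ σ * ‖D p j (t, x)‖ ≤ C)
    (h1 : ∀ t x, wt x ^ (σ + 1) * ‖D (p + 1) j (t, x)‖ ≤ C)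
    (ht : ∀ t₁ t₂ x, wt x ^ σ * ‖D p j (t₁, x) - D p j (t₂, x)‖ ≤ C * |(t₁ : ℝ) - t₂| ^ θ) :
    HB T (C * 3 ^ |σ + 1|) σ θ (D p j) := by
  have hC : 0 ≤ C := le_trans (mul_nonneg (Real.rpow_nonneg (wt_pos 0).le _) (norm_nonneg _))
    (h0 ⟨0, Set.left_mem_Icc.2 hT⟩ 0)
  have h3 : C ≤ C * 3 ^ |σ + 1| :=
    le_mul_of_one_le_right hC (Real.one_le_rpow (by norm_num) (abs_nonneg _))
  refine ⟨fun t x => (h0 t x).trans h3, fun t x y hxy => ?_, fun t₁ t₂ x => (ht t₁ t₂ x).trans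
    (mul_le_mul_of_nonneg_right h3 (by positivity))⟩
  have hw : 0 < wt2 x y ^ (σ + 1) := Real.rpow_pos_of_pos (wt2_pos x y) _
  have hb : ∀ z ∈ segment ℝ x y, ‖(D (p + 1) j (t, z)).curryLeft‖ ≤
      C * 3 ^ |σ + 1| / wt2 x y ^ (σ + 1) := by
    intro z hz
    have hn : ‖(D (p + 1) j (t, z)).curryLeft‖ = ‖D (p + 1) j (t, z)‖ :=
      (curryL n p).norm_map _
    rw [hn, le_div_iff₀ hw, mul_comm]
    calc wt2 x y ^ (σ + 1) * ‖D (p + 1) j (t, z)‖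
        ≤ 3 ^ |σ + 1| * wt z ^ (σ + 1) * ‖D (p + 1) j (t, z)‖ := by
          gcongr
          exact hxy.wt2_rpow_le hz _
      _ = 3 ^ |σ + 1| * (wt z ^ (σ + 1) * ‖D (p + 1) j (t, z)‖) := by ring
      _ ≤ 3 ^ |σ + 1| * C := by
          gcongr
          exact h1 t z
      _ = C * 3 ^ |σ + 1| := mul_comm _ _
  have key := (convex_segment x y).norm_image_sub_le_of_norm_hasFDerivWithin_le
    (fun z _ => (hD.space p j hj hp t z).hasFDerivWithinAt) hb
    (right_mem_segment ℝ x y) (left_mem_segment ℝ x y)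
  rw [div_mul_eq_mul_div, le_div_iff₀ hw] at key
  rwa [mul_comm]

theorem IsJet.lipschitz_time (hD : IsJet hT N s D) {p j : ℕ} (hj : j + 1 ≤ s)
    (hp : p + 2 * (j + 1) ≤ N) {C σ : ℝ} (h : ∀ t x, wt x ^ σ * ‖D p (j + 1) (t, x)‖ ≤ C)
    (t₁ t₂ : Set.Icc (0 : ℝ) T) (x : Spc n) :
    wt x ^ σ * ‖D p j (t₁, x) - D p j (t₂, x)‖ ≤ C * |(t₁ : ℝ) - t₂| ^ (1 : ℝ) := by
  have hc : Continuous fun τ : ℝ => D p (j + 1) (Set.projIcc 0 T hT τ, x) :=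
    (hD.cont p (j + 1) hj hp).comp (f := fun τ : ℝ => (Set.projIcc 0 T hT τ, x))
      (continuous_projIcc.prodMk continuous_const)
  have hw : 0 < wt x ^ σ := Real.rpow_pos_of_pos (wt_pos x) _
  rw [hD.time p j hj hp t₁, hD.time p j hj hp t₂, add_sub_add_left_eq_sub,
    intervalIntegral.integral_interval_sub_left (hc.intervalIntegrable _ _)
      (hc.intervalIntegrable _ _), Real.rpow_one]
  have key := intervalIntegral.norm_integral_le_of_norm_le_const (a := (t₂ : ℝ)) (b := t₁)
    (f := fun τ : ℝ => D p (j + 1) (Set.projIcc 0 T hT τ, x)) (C := C / wt x ^ σ) fun τ _ => by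
      rw [le_div_iff₀ hw, mul_comm]
      exact h _ x
  rw [div_mul_eq_mul_div, le_div_iff₀ hw] at key
  rwa [mul_comm]

end bounds

section embedding

variable {T lam lam' δ : ℝ} {k s : ℕ} {u : ℝ → Spc n → ℝ} {C : ℝ≥0∞}

theorem weighted_norm_mixJet_le (hlam : 0 < lam) (hC : C ≠ ⊤) (hu : eFn T k s lam lam' δ u ≤ C)
    {p j : ℕ} (hj : j ≤ s) (hp : p + 2 * j ≤ 2 * s + (k + 1)) (t : Set.Icc (0 : ℝ) T) (x : Spc n) :
    wt x ^ (δ + p) * ‖mixJet T u p j (t, x)‖ ≤ C.toReal :=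
  weighted_norm_le_of_eAniso0_le hlam.ne' hC
    ((eAniso0_le_eAnisoKS T lam δ u hj hp).trans (le_self_add.trans hu)) t x

theorem FMem.hb_holder (hT : 0 < T) (hlam : 0 < lam) (hlam' : 0 < lam') (hC : C ≠ ⊤)
    (hu : FMem T k s lam lam' δ u) (huC : eFn T k s lam lam' δ u ≤ C) {p j : ℕ} (hj : j ≤ s)
    (hp : p + 2 * j ≤ 2 * s + k) :
    HB T (C.toReal * 3 ^ |δ + p + 1|) (δ + p) (lam' / 2) (mixJet T u p j) := by
  refine (hu.1.isJet hT).hb hj (by omega)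
    (weighted_norm_mixJet_le hlam hC huC hj (by omega)) (fun t x => ?_)
    (weighted_norm_sub_le_of_eAniso0_le hlam' hC
      ((eAniso0_le_eAnisoKS T lam' δ u hj hp).trans (le_add_self.trans huC)))
  have := weighted_norm_mixJet_le hlam hC huC hj (by omega : p + 1 + 2 * j ≤ 2 * s + (k + 1)) t x
  rwa [Nat.cast_succ, ← add_assoc] at this

theorem FMem.hb_lipschitz (hT : 0 < T) (hlam : 0 < lam) (hC : C ≠ ⊤)
    (hu : FMem T k s lam lam' δ u) (huC : eFn T k s lam lam' δ u ≤ C) {p j : ℕ} (hj : j + 1 ≤ s)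
    (hp : p + 2 * j + 1 ≤ 2 * s + k) :
    HB T (C.toReal * 3 ^ |δ + p + 1|) (δ + p) 1 (mixJet T u p j) := by
  refine (hu.1.isJet hT).hb (by omega) (by omega)
    (weighted_norm_mixJet_le hlam hC huC (by omega) (by omega)) (fun t x => ?_)
    ((hu.1.isJet hT).lipschitz_time hj (by omega)
      (weighted_norm_mixJet_le hlam hC huC hj (by omega)))
  have := weighted_norm_mixJet_le hlam hC huC (by omega : j ≤ s)
    (by omega : p + 1 + 2 * j ≤ 2 * s + (k + 1)) t x
  rwa [Nat.cast_succ, ← add_assoc] at this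

theorem tDeriv_sub (hT : 0 < T) {j : ℕ} {u v : ℝ → Spc n → ℝ} {x : Spc n}
    (hu : ContDiffOn ℝ j (fun t => u t x) (Set.Icc 0 T))
    (hv : ContDiffOn ℝ j (fun t => v t x) (Set.Icc 0 T)) {t : ℝ} (ht : t ∈ Set.Icc 0 T) :
    tDeriv T j (u - v) t x = tDeriv T j u t x - tDeriv T j v t x :=
  iteratedDerivWithin_sub ht (uniqueDiffOn_Icc hT) (hu t ht) (hv t ht)

theorem AnisoReg.mixDeriv_sub (hT : 0 < T) {K L s r : ℕ} {u v : ℝ → Spc n → ℝ}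
    (hu : AnisoReg T K s u) (hv : AnisoReg T L r v) {p j : ℕ} (hjs : j ≤ s) (hjr : j ≤ r)
    (hpu : p + 2 * j ≤ 2 * s + K) (hpv : p + 2 * j ≤ 2 * r + L) {t : ℝ} (ht : t ∈ Set.Icc 0 T)
    (x : Spc n) :
    mixDeriv T p j (u - v) t x = mixDeriv T p j u t x - mixDeriv T p j v t x := by
  have h : (fun x => tDeriv T j (u - v) t x) =
      (fun x => tDeriv T j u t x) - fun x => tDeriv T j v t x := funext fun x =>
    tDeriv_sub hT ((hu.1 x).of_le (by exact_mod_cast hjs)) ((hv.1 x).of_le (by exact_mod_cast hjr))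
      ht
  rw [mixDeriv, h]
  exact iteratedFDeriv_sub_apply (hu.contDiff hjs hpu ht).contDiffAt
    (hv.contDiff hjr hpv ht).contDiffAt

end embedding

section conclusion

theorem eAnisoKS_ne_top {T lam δ : ℝ} {K s : ℕ} {u : ℝ → Spc n → ℝ}
    (h : ∀ p j, j ≤ s → p + 2 * j ≤ 2 * s + K →
      eAniso0 T lam (δ + p) (mixDeriv T p j u) ≠ ⊤) : eAnisoKS T K s lam δ u ≠ ⊤ := by
  refine ENNReal.sum_ne_top.2 fun b hb => ENNReal.sum_ne_top.2 fun m _ =>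
    ENNReal.sum_ne_top.2 fun j hj => ?_
  rw [Finset.mem_range] at hb hj
  split_ifs with hm
  · have := h (b + m) j (by omega) (by omega)
    rwa [Nat.cast_add, ← add_assoc] at this
  · exact ENNReal.zero_ne_top

theorem tendsto_eAnisoKS {T lam δ : ℝ} {K s : ℕ} {w : ℕ → ℝ → Spc n → ℝ}
    (h : ∀ p j, j ≤ s → p + 2 * j ≤ 2 * s + K →
      Tendsto (fun i => eAniso0 T lam (δ + p) (mixDeriv T p j (w i))) atTop (nhds 0)) :
    Tendsto (fun i => eAnisoKS T K s lam δ (w i)) atTop (nhds 0) := by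
  have : (0 : ℝ≥0∞) = ∑ b ∈ Finset.range (K + 1), ∑ m ∈ Finset.range (2 * s + 1),
      ∑ j ∈ Finset.range (s + 1), 0 := by simp
  rw [this]
  refine tendsto_finsetSum _ fun b hb => tendsto_finsetSum _ fun m _ =>
    tendsto_finsetSum _ fun j hj => ?_
  rw [Finset.mem_range] at hb hj
  split_ifs with hm
  · have := h (b + m) j (by omega) (by omega)
    simpa only [Nat.cast_add, ← add_assoc] using this
  · exact tendsto_const_nhds

theorem IsJet.mono {T : ℝ} {hT : 0 ≤ T} {N N' S S' : ℕ}
    {D : ∀ p : ℕ, ℕ → Set.Icc (0 : ℝ) T × Spc n → Jt n p} (hD : IsJet hT N S D) (hN : N' ≤ N)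
    (hS : S' ≤ S) : IsJet hT N' S' D :=
  ⟨fun p j hj hp => hD.cont p j (hj.trans hS) (hp.trans hN),
    fun p j hj hp => hD.space p j (hj.trans hS) (hp.trans hN),
    fun p j hj hp => hD.time p j (hj.trans hS) (hp.trans hN)⟩

/-- A sequence bounded in `𝓕^{k,𝐬(s,λ,λ',δ)}_T` has a subsequence whose mixed derivatives, up to
the order relevant for `𝓕^{k+1,𝐬(s-1,λ,λ',δ')}_T`, converge locally uniformly to a jet. -/
theorem exists_subseq_jet {k s : ℕ} {lam lam' δ T : ℝ} (hlam : 0 < lam)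
    (hlam' : 0 < lam') (hT : 0 < T) {u : ℕ → ℝ → Spc n → ℝ} {C : ℝ≥0∞} (hC : C ≠ ⊤)
    (hu : ∀ m, FMem T k s lam lam' δ (u m)) (huC : ∀ m, eFn T k s lam lam' δ (u m) ≤ C) :
    ∃ φ : ℕ → ℕ, StrictMono φ ∧ ∃ V : ∀ p : ℕ, ℕ → C(Set.Icc (0 : ℝ) T × Spc n, Jt n p),
      ∀ p j, j ≤ s → p + 2 * j ≤ 2 * s + k →
        ∃ f : ℕ → C(Set.Icc (0 : ℝ) T × Spc n, Jt n p),
          (∀ m, ⇑(f m) = mixJet T (u (φ m)) p j) ∧ Tendsto f atTop (nhds (V p j)) := by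
  have hcont : ∀ m (q : ℕ × ℕ), q.2 ≤ s ∧ q.1 + 2 * q.2 ≤ 2 * s + k →
      Continuous (mixJet T (u m) q.1 q.2) := fun m q hq =>
    ((hu m).1.isJet hT).cont q.1 q.2 hq.1 (by omega)
  let U : ℕ → ∀ q : ℕ × ℕ, C(Set.Icc (0 : ℝ) T × Spc n, Jt n q.1) := fun m q =>
    if hq : q.2 ≤ s ∧ q.1 + 2 * q.2 ≤ 2 * s + k then ⟨mixJet T (u m) q.1 q.2, hcont m q hq⟩ else 0
  have hU : ∀ m q, HB T (C.toReal * 3 ^ |δ + q.1 + 1|) (δ + q.1) (lam' / 2) (U m q) := by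
    intro m q
    by_cases hq : q.2 ≤ s ∧ q.1 + 2 * q.2 ≤ 2 * s + k
    · simp only [U, dif_pos hq]
      exact (hu m).hb_holder hT hlam hlam' hC (huC m) hq.1 hq.2
    · have hC' : 0 ≤ C.toReal * 3 ^ |δ + q.1 + 1| := by positivity
      simp only [U, dif_neg hq]
      refine ⟨fun t x => ?_, fun t x y _ => ?_, fun t₁ t₂ x => ?_⟩ <;>
        simp only [ContinuousMap.coe_zero, Pi.zero_apply, sub_self, norm_zero, mul_zero] <;>
        positivity
  obtain ⟨φ, hφ, V, hV⟩ := exists_subseq_of_HB (F := fun q : ℕ × ℕ => Jt n q.1) T _ _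
    (by positivity : 0 < lam' / 2) U hU
  refine ⟨φ, hφ, fun p j => V (p, j), fun p j hj hp =>
    ⟨fun m => U (φ m) (p, j), fun m => ?_, hV (p, j)⟩⟩
  simp only [U, dif_pos (show j ≤ s ∧ p + 2 * j ≤ 2 * s + k from ⟨hj, hp⟩)]
  rfl

end conclusion

/-- compact embedding `𝓕^{k,𝐬(s,λ,λ',δ)}_T ↪ 𝓕^{k+1,𝐬(s-1,λ,λ',δ')}_T`. -/
theorem stmt4 (n : ℕ) (s k : ℕ) (hs : 1 ≤ s) (lam lam' δ δ' T : ℝ)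
    (h1 : 0 < lam) (h2 : lam < lam') (h3 : lam' < 1) (h4 : δ' < δ) (hT : 0 < T) :
    ∀ u : ℕ → ℝ → Spc n → ℝ,
      (∃ C : ℝ≥0∞, C ≠ ⊤ ∧ ∀ m, FMem T k s lam lam' δ (u m) ∧
        eFn T k s lam lam' δ (u m) ≤ C) →
      ∃ φ : ℕ → ℕ, StrictMono φ ∧ ∃ v : ℝ → Spc n → ℝ,
        FMem T (k + 1) (s - 1) lam lam' δ' v ∧
        Tendsto (fun m => eFn T (k + 1) (s - 1) lam lam' δ' (u (φ m) - v)) atTop (nhds 0) := by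
  rintro u ⟨C, hC, hu⟩
  have h1' : 0 < lam' := h1.trans h2
  obtain ⟨φ, hφ, V, hV⟩ := exists_subseq_jet h1 h1' hT hC (fun m => (hu m).1) fun m => (hu m).2
  have hjet : IsJet hT.le (2 * (s - 1) + (k + 1 + 1)) (s - 1) fun p j => V p j := by
    refine IsJet.of_tendsto (fun m => ((hu (φ m)).1.1.isJet hT).mono (by omega) (by omega))
      (fun p j _ _ => (V p j).continuous) fun p j hj hp => ?_
    obtain ⟨f, hf, hfV⟩ := hV p j (by omega) (by omega)
    simp only [← hf]
    exact ContinuousMap.tendsto_iff_tendstoLocallyUniformly.1 hfV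
  set v := jetFun hT.le fun p j => V p j
  have hv : ∀ p j, j ≤ s - 1 → p + 2 * j ≤ 2 * (s - 1) + (k + 1 + 1) →
      ∀ (t : Set.Icc (0 : ℝ) T) x, mixDeriv T p j v t x = V p j (t, x) :=
    fun p j hj hp t x => hjet.mixDeriv_jetFun hT hj hp t x
  have hreg : AnisoReg T (k + 1 + 1) (s - 1) v := hjet.anisoReg hT
  have hsub : ∀ m p j, j ≤ s - 1 → p + 2 * j ≤ 2 * (s - 1) + (k + 1 + 1) →
      ∀ (t : Set.Icc (0 : ℝ) T) x, mixDeriv T p j (u (φ m) - v) t x =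
        mixJet T (u (φ m)) p j (t, x) - V p j (t, x) := by
    intro m p j hj hp t x
    rw [(hu (φ m)).1.1.mixDeriv_sub hT hreg (by omega) hj (by omega) hp t.2, hv p j hj hp]
    rfl
  have hholder : ∀ p j, j ≤ s - 1 → p + 2 * j ≤ 2 * (s - 1) + (k + 1 + 1) →
      eAniso0 T lam (δ' + p) (mixDeriv T p j v) ≠ ⊤ ∧
      Tendsto (fun m => eAniso0 T lam (δ' + p) (mixDeriv T p j (u (φ m) - v))) atTop
        (nhds 0) := by
    intro p j hj hp
    obtain ⟨f, hf, hfV⟩ := hV p j (by omega) (by omega)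
    have hb : ∀ m, HB T (C.toReal * 3 ^ |δ + p + 1|) (δ + p) (lam' / 2) (f m) := fun m => by
      rw [hf]
      exact (hu _).1.hb_holder hT h1 h1' hC (hu _).2 (by omega) (by omega)
    exact ⟨(HB.of_tendsto hb hfV).eAniso0_ne_top hT.le (by linarith) h1 (by linarith)
      (by linarith) (hv p j hj hp), tendsto_eAniso0_of_HB hT.le hb hfV (by linarith) h1
      (by linarith) (by linarith) fun m => by rw [hf]; exact hsub m p j hj hp⟩
  have hlipschitz : ∀ p j, j ≤ s - 1 → p + 2 * j ≤ 2 * (s - 1) + (k + 1) →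
      eAniso0 T lam' (δ' + p) (mixDeriv T p j v) ≠ ⊤ ∧
      Tendsto (fun m => eAniso0 T lam' (δ' + p) (mixDeriv T p j (u (φ m) - v))) atTop
        (nhds 0) := by
    intro p j hj hp
    obtain ⟨f, hf, hfV⟩ := hV p j (by omega) (by omega)
    have hb : ∀ m, HB T (C.toReal * 3 ^ |δ + p + 1|) (δ + p) 1 (f m) := fun m => by
      rw [hf]
      exact (hu _).1.hb_lipschitz hT h1 hC (hu _).2 (by omega) (by omega)
    exact ⟨(HB.of_tendsto hb hfV).eAniso0_ne_top hT.le (by linarith) h1' h3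
      (by linarith) (hv p j hj (by omega)), tendsto_eAniso0_of_HB hT.le hb hfV (by linarith) h1'
      h3 (by linarith) fun m => by rw [hf]; exact hsub m p j hj (by omega)⟩
  refine ⟨φ, hφ, v, ⟨hreg, ENNReal.add_ne_top.2
    ⟨eAnisoKS_ne_top fun p j hj hp => (hholder p j hj hp).1,
      eAnisoKS_ne_top fun p j hj hp => (hlipschitz p j hj hp).1⟩⟩, ?_⟩
  simpa only [eFn, add_zero] using
    (tendsto_eAnisoKS fun p j hj hp => (hholder p j hj hp).2).add
      (tendsto_eAnisoKS fun p j hj hp => (hlipschitz p j hj hp).2)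

end NSdeRham

end
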